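/- arXiv:2306.00847 — 2 statements merged into one kernel-verified Lean document; each statement's English description precedes it below -/
import Mathlib

section
/- Let m, n be positive integers. If A ∈ M_{m,n}(ℝ) is badly approximable, then for any decreasing function ψ : ℝ⁺ → ℝ⁺ and any 0 ≤ s ≤ m: ℋ^s(W_A(ψ)) = 0 if ∑_{q=1}^∞ q^{n-1} ψ(q)^s < ∞, and ℋ^s(W_A(ψ)) = ℋ^s([0,1]^m) if ∑_{q=1}^∞ q^{n-1} ψ(q)^s = ∞. -/
open MeasureTheory Filter

/-- Distance from `x ∈ ℝ^k` to the nearest integer vector, in the sup norm. -/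
noncomputable def intDist {k : ℕ} (x : Fin k → ℝ) : ℝ :=
  ⨅ p : Fin k → ℤ, ‖x - (fun i => (p i : ℝ))‖

/-- The set `W_A(ψ)` of `ψ`-approximable targets `b ∈ [0,1]^m` for `A`. -/
noncomputable def WA (m n : ℕ) (A : Matrix (Fin m) (Fin n) ℝ) (ψ : ℝ → ℝ) :
    Set (Fin m → ℝ) :=
  {b | b ∈ Set.Icc (0 : Fin m → ℝ) 1 ∧
    {q : Fin n → ℤ |
      intDist (A.mulVec (fun j => (q j : ℝ)) - b) < ψ ‖(fun j => (q j : ℝ))‖}.Infinite}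

/-- `A` is badly approximable: `liminf_{‖q‖ → ∞} ‖q‖^{n/m} ‖Aq‖_ℤ > 0`.  On `ℤ^n`
the filter `‖q‖ → ∞` coincides with the cofinite filter. -/
def BadlyApproximable (m n : ℕ) (A : Matrix (Fin m) (Fin n) ℝ) : Prop :=
  0 < Filter.liminf (fun q : Fin n → ℤ =>
    ‖(fun j => (q j : ℝ))‖ ^ ((n : ℝ) / m) * intDist (A.mulVec (fun j => (q j : ℝ))))
    Filter.cofinite

/-- Weighted packing: disjoint sup-norm balls inside a ball of radius `T` have total volume at most
that of the big ball. -/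
theorem sum_pow_le_of_pairwise {m : ℕ} {ι : Type*} (S : Finset ι) (y : ι → Fin m → ℝ)
    (R : ι → ℝ) (hR : ∀ i ∈ S, 0 < R i)
    (hsep : ∀ i ∈ S, ∀ j ∈ S, i ≠ j → R i + R j ≤ dist (y i) (y j))
    (u : Fin m → ℝ) (T : ℝ) (hT : 0 ≤ T) (hin : ∀ i ∈ S, dist (y i) u + R i ≤ T) :
    ∑ i ∈ S, R i ^ m ≤ T ^ m := by
  have hvol : ∑ i ∈ S, volume (Metric.ball (y i) (R i)) ≤ volume (Metric.closedBall u T) := by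
    rw [← measure_biUnion_finset]
    · refine measure_mono (Set.iUnion₂_subset fun i hi => ?_)
      exact (Metric.ball_subset_ball' (by linarith [hin i hi])).trans Metric.ball_subset_closedBall
    · intro i hi j hj hij
      exact Metric.ball_disjoint_ball (hsep i hi j hj hij)
    · exact fun i _ => measurableSet_ball
  rw [Real.volume_pi_closedBall _ hT, Finset.sum_congr rfl
    (fun i hi => Real.volume_pi_ball (y i) (hR i hi)), ← ENNReal.ofReal_sum_of_nonneg
    (fun i hi => by have := hR i hi; positivity),
    ENNReal.ofReal_le_ofReal_iff (by positivity)] at hvol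
  simp only [mul_pow, Fintype.card_fin, ← Finset.mul_sum] at hvol
  exact le_of_mul_le_mul_left hvol (by positivity)

theorem card_mul_pow_le_of_separated {m : ℕ} (S : Finset (Fin m → ℝ)) {d : ℝ} (hd : 0 < d)
    (hsep : ∀ y ∈ S, ∀ z ∈ S, y ≠ z → 2 * d ≤ dist y z)
    (u : Fin m → ℝ) {T : ℝ} (hT : 0 ≤ T) (hin : ∀ y ∈ S, dist y u ≤ T) :
    (S.card : ℝ) ≤ ((T + d) / d) ^ m := by
  have h := sum_pow_le_of_pairwise S (fun y => y) (fun _ => d) (fun _ _ => hd)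
    (fun y hy z hz hyz => by linarith [hsep y hy z hz hyz]) u (T + d) (by linarith)
    (fun y hy => by linarith [hin y hy])
  rw [Finset.sum_const, nsmul_eq_mul] at h
  rw [div_pow, le_div_iff₀ (by positivity)]
  exact h

theorem finite_of_separated {m : ℕ} {s : Set (Fin m → ℝ)} {d : ℝ} (hd : 0 < d)
    (hsep : ∀ y ∈ s, ∀ z ∈ s, y ≠ z → 2 * d ≤ dist y z)
    (u : Fin m → ℝ) {T : ℝ} (hT : 0 ≤ T) : (s ∩ Metric.closedBall u T).Finite := by
  by_contra hinf
  obtain ⟨N, hN⟩ := exists_nat_gt (((T + d) / d) ^ m)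
  obtain ⟨S, hS, hcard⟩ := Set.Infinite.exists_subset_card_eq hinf N
  have := card_mul_pow_le_of_separated S hd (fun y hy z hz => hsep y (hS hy).1 z (hS hz).1) u hT
    (fun y hy => (hS hy).2)
  rw [hcard] at this
  linarith

/-- A finite set whose `t`-neighbourhood covers the ball of radius `σ - t` has at least
`((σ - t) / t) ^ m` elements. -/
theorem pow_le_card_of_cover {m : ℕ} (S : Finset (Fin m → ℝ)) {t r : ℝ} (ht : 0 < t)
    (u : Fin m → ℝ) (hr : 0 ≤ r)
    (hcov : ∀ x ∈ Metric.closedBall u r, ∃ y ∈ S, dist x y ≤ t) :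
    (r / t) ^ m ≤ S.card := by
  have hvol : volume (Metric.closedBall u r) ≤ ∑ y ∈ S, volume (Metric.closedBall y t) := by
    refine (measure_mono fun x hx => ?_).trans (measure_biUnion_finset_le S _)
    obtain ⟨y, hy, hxy⟩ := hcov x hx
    exact Set.mem_biUnion hy hxy
  rw [Real.volume_pi_closedBall _ hr, Finset.sum_congr rfl
    (fun i hi => Real.volume_pi_closedBall i ht.le), ← ENNReal.ofReal_sum_of_nonneg
    (fun i hi => by positivity), ENNReal.ofReal_le_ofReal_iff (by positivity)] at hvol
  simp only [mul_pow, Fintype.card_fin, Finset.sum_const, nsmul_eq_mul] at hvol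
  rw [div_pow, div_le_iff₀ (by positivity)]
  have h2 : (0 : ℝ) < 2 ^ m := by positivity
  refine le_of_mul_le_mul_left ?_ h2
  linarith

/-- An increasing sequence of uniformly discrete, relatively dense subsets `P k` of `ℝ^m`, with
separation and covering radius comparable to `d k`, where `d` is geometric with small ratio. -/
structure DeloneTower {m : ℕ} (P : ℕ → Set (Fin m → ℝ)) (d : ℕ → ℝ) (θ Λ : ℝ) : Prop where
  one_le : 1 ≤ Λ
  ratio_pos : 0 < θ
  ratio_le : θ ≤ 1 / (128 * Λ)
  pos : ∀ k, 0 < d k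
  succ : ∀ k, d (k + 1) = θ * d k
  mono : Monotone P
  sep : ∀ k, ∀ y ∈ P k, ∀ z ∈ P k, y ≠ z → 2 * d k ≤ dist y z
  cov : ∀ k x, ∃ y ∈ P k, dist x y ≤ Λ * d k

namespace DeloneTower

variable {m : ℕ} {P : ℕ → Set (Fin m → ℝ)} {d : ℕ → ℝ} {θ Λ : ℝ}

theorem ratio_lt_one (H : DeloneTower P d θ Λ) : θ < 1 := by
  refine H.ratio_le.trans_lt ?_
  have := H.one_le
  rw [div_lt_one (by positivity)]
  linarith

theorem tendsto_zero (H : DeloneTower P d θ Λ) : Tendsto d atTop (nhds 0) := by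
  have h : ∀ k, d k = d 0 * θ ^ k := by
    intro k
    induction k with
    | zero => simp
    | succ k ih => rw [H.succ, ih]; ring
  rw [funext h]
  simpa using (tendsto_pow_atTop_nhds_zero_of_lt_one H.ratio_pos.le H.ratio_lt_one).const_mul (d 0)

theorem exists_new_points (hm : 0 < m) (H : DeloneTower P d θ Λ) {R : ℕ → ℝ}
    (hR : ∀ k, 0 < R k) (hRd : ∀ k, R k ≤ d k) (x : Fin m → ℝ) {σ : ℝ} (l : ℕ)
    (hl : d l ≤ σ) (hl' : Λ * d (l + 1) ≤ σ / 2) (S : Finset ((Fin m → ℝ) × ℕ))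
    (hS : ∀ p ∈ S, p.1 ∈ P l ∧ dist p.1 x ≤ σ)
    (hSsep : ∀ p ∈ S, ∀ p' ∈ S, p ≠ p' → R p.2 + R p'.2 ≤ dist p.1 p'.1)
    (hV : ∑ p ∈ S, R p.2 ^ m < (1 / (2 * Λ)) ^ m / (8 * 2 ^ m) * σ ^ m) :
    ∃ G : Finset (Fin m → ℝ), (∀ y ∈ G, y ∈ P (l + 1) ∧ y ∉ P l ∧ dist y x ≤ σ ∧
      ∀ p ∈ S, R p.2 + R (l + 1) ≤ dist y p.1) ∧
      (1 / (2 * Λ)) ^ m / 2 * (σ / d (l + 1)) ^ m ≤ G.card := by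
  classical
  have hΛ := H.one_le
  have hdl := H.pos l
  have hdl1 := H.pos (l + 1)
  have hσ : 0 < σ := hdl.trans_le hl
  have hfin : (P (l + 1) ∩ Metric.closedBall x σ).Finite :=
    finite_of_separated hdl1 (H.sep (l + 1)) x hσ.le
  set Y := hfin.toFinset with hY
  have memY : ∀ y, y ∈ Y ↔ y ∈ P (l + 1) ∧ dist y x ≤ σ := by
    intro y; simp [hY]
  set a : ℝ := (1 / (2 * Λ)) ^ m with ha
  have ha0 : 0 < a := by positivity
  set b : ℝ := (σ / d (l + 1)) ^ m with hb
  have hb0 : 0 < b := by positivity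
  have hsmall : (8 * θ) ^ m ≤ a / 8 := by
    have h1 : 8 * θ ≤ 1 / 8 * (1 / (2 * Λ)) := by
      have := H.ratio_le
      calc 8 * θ ≤ 8 * (1 / (128 * Λ)) := by linarith
        _ = 1 / 8 * (1 / (2 * Λ)) := by field_simp; norm_num
    calc (8 * θ) ^ m ≤ (1 / 8 * (1 / (2 * Λ))) ^ m :=
          pow_le_pow_left₀ (by have := H.ratio_pos; positivity) h1 m
      _ = (1 / 8) ^ m * a := by rw [mul_pow]
      _ ≤ (1 / 8) ^ 1 * a := by
          gcongr ?_ * a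
          exact pow_le_pow_of_le_one (by norm_num) (by norm_num) hm
      _ = a / 8 := by ring
  have hYcard : a * b ≤ Y.card := by
    have h := pow_le_card_of_cover Y (t := Λ * d (l + 1)) (r := σ / 2) (by positivity) x
      (by positivity) (by
        intro z hz
        obtain ⟨y, hy, hzy⟩ := H.cov (l + 1) z
        refine ⟨y, (memY y).2 ⟨hy, ?_⟩, hzy⟩
        have hz' : dist z x ≤ σ / 2 := hz
        have := dist_triangle y z x
        rw [dist_comm y z] at this
        linarith)
    refine le_trans (le_of_eq ?_) h
    rw [ha, hb, ← mul_pow]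
    congr 1
    field_simp
  have hold : ∀ T : Finset (Fin m → ℝ), (∀ y ∈ T, y ∈ P l ∧ dist y x ≤ σ) →
      (T.card : ℝ) ≤ (2 * θ) ^ m * b := by
    intro T hT
    have h := card_mul_pow_le_of_separated T hdl (fun y hy z hz => H.sep l y (hT y hy).1 z
      (hT z hz).1) x hσ.le (fun y hy => (hT y hy).2)
    refine h.trans ?_
    rw [hb, ← mul_pow]
    refine pow_le_pow_left₀ (by positivity) ?_ m
    have hθ := H.ratio_pos
    rw [H.succ, div_le_iff₀ hdl]
    have : 2 * θ * (σ / (θ * d l)) * d l = 2 * σ := by field_simp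
    linarith
  have hScard : (S.card : ℝ) ≤ (2 * θ) ^ m * b := by
    have hinj : Set.InjOn (Prod.fst : (Fin m → ℝ) × ℕ → _) (S : Set ((Fin m → ℝ) × ℕ)) := by
      intro p hp p' hp' hpp
      by_contra hne
      have h1 := hSsep p hp p' hp' hne
      rw [hpp, dist_self] at h1
      linarith [hR p.2, hR p'.2]
    rw [← Finset.card_image_of_injOn hinj]
    apply hold
    intro y hy
    obtain ⟨p, hp, rfl⟩ := Finset.mem_image.1 hy
    exact hS p hp
  set G := Y.filter (fun y => y ∉ P l ∧ ∀ p ∈ S, R p.2 + R (l + 1) ≤ dist y p.1) with hG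
  set B1 := Y.filter (fun y => y ∈ P l)
  set C : (Fin m → ℝ) × ℕ → Finset (Fin m → ℝ) :=
    fun p => Y.filter (fun y => dist y p.1 ≤ R p.2 + R (l + 1))
  have hsub : Y ⊆ G ∪ (B1 ∪ S.biUnion C) := by
    intro y hy
    by_cases h1 : y ∈ P l
    · exact Finset.mem_union_right _ (Finset.mem_union_left _ (Finset.mem_filter.2 ⟨hy, h1⟩))
    by_cases h2 : ∀ p ∈ S, R p.2 + R (l + 1) ≤ dist y p.1
    · exact Finset.mem_union_left _ (Finset.mem_filter.2 ⟨hy, h1, h2⟩)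
    · push Not at h2
      obtain ⟨p, hp, hlt⟩ := h2
      exact Finset.mem_union_right _ (Finset.mem_union_right _ (Finset.mem_biUnion.2
        ⟨p, hp, Finset.mem_filter.2 ⟨hy, hlt.le⟩⟩))
  have hC : ∀ p ∈ S, ((C p).card : ℝ) ≤ 2 ^ m * (R p.2 ^ m / d (l + 1) ^ m) + 4 ^ m := by
    intro p hp
    have hR1 := hR p.2
    have hR2 := hR (l + 1)
    have h := card_mul_pow_le_of_separated (C p) hdl1 (fun y hy z hz => H.sep (l + 1) y
      ((memY y).1 (Finset.mem_filter.1 hy).1).1 z ((memY z).1 (Finset.mem_filter.1 hz).1).1)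
      p.1 (T := R p.2 + R (l + 1)) (by positivity) (fun y hy => (Finset.mem_filter.1 hy).2)
    refine h.trans ?_
    have h1 : (R p.2 + R (l + 1) + d (l + 1)) / d (l + 1) ≤ R p.2 / d (l + 1) + 2 := by
      have := hRd (l + 1)
      rw [div_add' _ _ _ hdl1.ne']
      refine div_le_div_of_nonneg_right ?_ hdl1.le
      linarith
    calc _ ≤ (R p.2 / d (l + 1) + 2) ^ m := pow_le_pow_left₀ (by positivity) h1 m
      _ ≤ 2 ^ (m - 1) * ((R p.2 / d (l + 1)) ^ m + 2 ^ m) :=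
          add_pow_le (by positivity) (by positivity) m
      _ ≤ 2 ^ m * ((R p.2 / d (l + 1)) ^ m + 2 ^ m) := by
          gcongr
          · norm_num
          · omega
      _ = _ := by rw [div_pow, mul_add, ← mul_pow]; norm_num
  have hBU : ((S.biUnion C).card : ℝ) ≤ (a / 8) * b + (a / 8) * b := by
    have h1 : ((S.biUnion C).card : ℝ) ≤ ∑ p ∈ S, ((C p).card : ℝ) := by
      exact_mod_cast Finset.card_biUnion_le
    refine h1.trans ((Finset.sum_le_sum hC).trans ?_)
    rw [Finset.sum_add_distrib, ← Finset.mul_sum, ← Finset.sum_div, Finset.sum_const,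
      nsmul_eq_mul]
    refine add_le_add ?_ ?_
    · have : a / 8 * b = 2 ^ m * ((a / (8 * 2 ^ m) * σ ^ m) / d (l + 1) ^ m) := by
        rw [hb, div_pow]; field_simp
      rw [this]
      gcongr
    · calc (S.card : ℝ) * 4 ^ m ≤ (2 * θ) ^ m * b * 4 ^ m := by gcongr
        _ = (8 * θ) ^ m * b := by
            rw [show (8 : ℝ) * θ = 2 * θ * 4 by ring, mul_pow (2 * θ) 4]; ring
        _ ≤ a / 8 * b := by gcongr
  have hB1 : (B1.card : ℝ) ≤ (a / 8) * b := by
    refine (hold B1 fun y hy => ⟨(Finset.mem_filter.1 hy).2,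
      ((memY y).1 (Finset.mem_filter.1 hy).1).2⟩).trans ?_
    gcongr
    refine le_trans (pow_le_pow_left₀ ?_ ?_ m) hsmall <;> linarith [H.ratio_pos]
  have hcard : (Y.card : ℝ) ≤ G.card + (B1.card + (S.biUnion C).card) := by
    have h1 := Finset.card_le_card hsub
    have h2 := Finset.card_union_le G (B1 ∪ S.biUnion C)
    have h3 := Finset.card_union_le B1 (S.biUnion C)
    exact_mod_cast h1.trans (h2.trans (by omega))
  refine ⟨G, fun y hy => ?_, ?_⟩
  · obtain ⟨h1, h2, h3⟩ := Finset.mem_filter.1 hy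
    exact ⟨((memY y).1 h1).1, h2, ((memY y).1 h1).2, h3⟩
  · nlinarith [mul_pos ha0 hb0]

/-- In every ball one can find a finite family of points of `⋃ k, P (k + 1) \ P k`, of arbitrarily
high level, whose balls of radius `R` are disjoint and fill a fixed proportion of the ball. -/
theorem exists_separated_family (hm : 0 < m) (H : DeloneTower P d θ Λ) {R : ℕ → ℝ}
    (hR : ∀ k, 0 < R k) (hRd : ∀ k, R k ≤ d k) (hdiv : ¬ Summable fun k => (R k / d k) ^ m)
    (x : Fin m → ℝ) {σ : ℝ} (hσ : 0 < σ) (K : ℕ) :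
    ∃ S : Finset ((Fin m → ℝ) × ℕ), (∀ p ∈ S, ∃ l, p.2 = l + 1 ∧ K ≤ l ∧ p.1 ∈ P (l + 1) ∧
      p.1 ∉ P l ∧ dist p.1 x ≤ σ) ∧
      (∀ p ∈ S, ∀ p' ∈ S, p ≠ p' → R p.2 + R p'.2 ≤ dist p.1 p'.1) ∧
      (1 / (2 * Λ)) ^ m / (8 * 2 ^ m) * σ ^ m ≤ ∑ p ∈ S, R p.2 ^ m := by
  classical
  by_contra hcon
  push Not at hcon
  have hΛ := H.one_le
  have hev : ∀ᶠ l in atTop, d l ≤ σ ∧ Λ * d (l + 1) ≤ σ / 2 := by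
    refine (H.tendsto_zero.eventually_le_const hσ).and ?_
    have h1 : Tendsto (fun l => Λ * d (l + 1)) atTop (nhds (Λ * 0)) :=
      (H.tendsto_zero.comp (tendsto_add_atTop_nat 1)).const_mul Λ
    rw [mul_zero] at h1
    exact h1.eventually_le_const (by positivity)
  obtain ⟨K0, hK0⟩ := eventually_atTop.1 hev
  set K1 := max K K0 with hK1
  have key : ∀ j : ℕ, ∃ S : Finset ((Fin m → ℝ) × ℕ), (∀ p ∈ S, ∃ l, p.2 = l + 1 ∧ K ≤ l ∧
      l < K1 + j ∧ p.1 ∈ P (l + 1) ∧ p.1 ∉ P l ∧ dist p.1 x ≤ σ) ∧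
      (∀ p ∈ S, ∀ p' ∈ S, p ≠ p' → R p.2 + R p'.2 ≤ dist p.1 p'.1) ∧
      (1 / (2 * Λ)) ^ m / 2 * σ ^ m *
        ∑ i ∈ Finset.range j, (R (i + (K1 + 1)) / d (i + (K1 + 1))) ^ m ≤ ∑ p ∈ S, R p.2 ^ m := by
    intro j
    induction j with
    | zero => exact ⟨∅, by simp⟩
    | succ j ih =>
      obtain ⟨S, hS, hsep, hsum⟩ := ih
      have hV := hcon S (fun p hp => by
        obtain ⟨l, h1, h2, -, h3⟩ := hS p hp
        exact ⟨l, h1, h2, h3⟩) hsep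
      have hKj := hK0 (K1 + j) (by omega)
      obtain ⟨G, hG, hGcard⟩ := H.exists_new_points hm hR hRd x (K1 + j) hKj.1 hKj.2 S
        (fun p hp => by
          obtain ⟨l, -, -, h3, h4, -, h5⟩ := hS p hp
          exact ⟨H.mono (by omega) h4, h5⟩) hsep hV
      set N : Finset ((Fin m → ℝ) × ℕ) := G.image (fun y => (y, K1 + j + 1)) with hN
      have hinj : Function.Injective (fun y : Fin m → ℝ => (y, K1 + j + 1)) := by
        intro y z h
        exact congrArg Prod.fst h
      have hdisj : Disjoint S N := by
        rw [Finset.disjoint_left]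
        intro p hp hp'
        obtain ⟨y, -, rfl⟩ := Finset.mem_image.1 hp'
        obtain ⟨l, h1, -, h3, -⟩ := hS _ hp
        simp only at h1
        omega
      refine ⟨S ∪ N, ?_, ?_, ?_⟩
      · intro p hp
        rcases Finset.mem_union.1 hp with hp | hp
        · obtain ⟨l, h1, h2, h3, h4⟩ := hS p hp
          exact ⟨l, h1, h2, by omega, h4⟩
        · obtain ⟨y, hy, rfl⟩ := Finset.mem_image.1 hp
          obtain ⟨h1, h2, h3, -⟩ := hG y hy
          exact ⟨K1 + j, rfl, by omega, by omega, h1, h2, h3⟩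
      · intro p hp p' hp' hne
        rcases Finset.mem_union.1 hp with hp | hp <;> rcases Finset.mem_union.1 hp' with hp' | hp'
        · exact hsep p hp p' hp' hne
        · obtain ⟨y, hy, rfl⟩ := Finset.mem_image.1 hp'
          rw [dist_comm]
          exact (hG y hy).2.2.2 p hp
        · obtain ⟨y, hy, rfl⟩ := Finset.mem_image.1 hp
          rw [add_comm]
          exact (hG y hy).2.2.2 p' hp'
        · obtain ⟨y, hy, rfl⟩ := Finset.mem_image.1 hp
          obtain ⟨z, hz, rfl⟩ := Finset.mem_image.1 hp'
          have hyz : y ≠ z := fun h => hne (by rw [h])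
          have := H.sep _ y (hG y hy).1 z (hG z hz).1 hyz
          simp only
          linarith [hRd (K1 + j + 1)]
      · rw [Finset.sum_union hdisj, Finset.sum_range_succ, mul_add]
        refine add_le_add hsum ?_
        rw [hN, Finset.sum_image hinj.injOn]
        simp only [Finset.sum_const, nsmul_eq_mul]
        rw [show j + (K1 + 1) = K1 + j + 1 by ring]
        have hR' := hR (K1 + j + 1)
        have hd' := H.pos (K1 + j + 1)
        calc _ = (1 / (2 * Λ)) ^ m / 2 * (σ / d (K1 + j + 1)) ^ m * R (K1 + j + 1) ^ m := by
              rw [div_pow (R _), div_pow σ]; ring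
          _ ≤ _ := by gcongr
  have hdiv' : ¬ Summable fun i => (R (i + (K1 + 1)) / d (i + (K1 + 1))) ^ m := fun h =>
    hdiv ((summable_nat_add_iff (f := fun k => (R k / d k) ^ m) (K1 + 1)).1 h)
  rw [not_summable_iff_tendsto_nat_atTop_of_nonneg (fun i => by
    have := hR (i + (K1 + 1)); have := H.pos (i + (K1 + 1)); positivity)] at hdiv'
  have hpos : 0 < (1 / (2 * Λ)) ^ m / 2 * σ ^ m := by positivity
  obtain ⟨j, hj⟩ := ((hdiv'.const_mul_atTop hpos).eventually_ge_atTop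
    ((1 / (2 * Λ)) ^ m / (8 * 2 ^ m) * σ ^ m)).exists
  obtain ⟨S, hS, hsep, hsum⟩ := key j
  have hV := hcon S (fun p hp => by
    obtain ⟨l, h1, h2, -, h3⟩ := hS p hp
    exact ⟨l, h1, h2, h3⟩) hsep
  linarith

/-- Points within `φ (l + 1)` of a point of `P (l + 1) \ P l` for infinitely many `l`. -/
def limitSet (P : ℕ → Set (Fin m → ℝ)) (φ : ℕ → ℝ) : Set (Fin m → ℝ) :=
  {z | ∀ K : ℕ, ∃ l, K ≤ l ∧ ∃ y ∈ P (l + 1), y ∉ P l ∧ dist z y ≤ φ (l + 1)}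

theorem volume_compl_limitSet (hm : 0 < m) (H : DeloneTower P d θ Λ) {φ : ℕ → ℝ}
    (hφ : ∀ k, 0 < φ k) (hdiv : ¬ Summable fun k => (min (φ k) (d k) / d k) ^ m) :
    volume (limitSet P φ)ᶜ = 0 := by
  have hΛ := H.one_le
  set R : ℕ → ℝ := fun k => min (φ k) (d k) with hRdef
  have hR : ∀ k, 0 < R k := fun k => lt_min (hφ k) (H.pos k)
  have hRd : ∀ k, R k ≤ d k := fun k => min_le_right _ _
  set U : ℕ → Set (Fin m → ℝ) := fun K => ⋃ l ∈ Set.Ici K, ⋃ y ∈ P (l + 1) \ P l,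
    Metric.ball y (R (l + 1)) with hU
  have hsub : (limitSet P φ)ᶜ ⊆ ⋃ K, (U K)ᶜ := by
    rw [← Set.compl_iInter]
    refine Set.compl_subset_compl.2 fun z hz K => ?_
    have hz' := Set.mem_iInter.1 hz K
    simp only [hU, Set.mem_iUnion] at hz'
    obtain ⟨l, hl, y, hy, hzy⟩ := hz'
    exact ⟨l, hl, y, hy.1, hy.2, (Metric.mem_ball.1 hzy).le.trans (min_le_left _ _)⟩
  refine measure_mono_null hsub (measure_iUnion_null fun K => ?_)
  have hopen : IsOpen (U K) :=
    isOpen_biUnion fun l _ => isOpen_biUnion fun y _ => Metric.isOpen_ball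
  set c : ℝ := (1 / (2 * Λ)) ^ m / (8 * 2 ^ m) * (1 / 2) ^ m with hc
  have hc0 : 0 < c := by positivity
  have hbound : ∀ x : Fin m → ℝ, ∀ r : ℝ, 0 < r →
      volume ((U K)ᶜ ∩ Metric.closedBall x r) / volume (Metric.closedBall x r)
        ≤ ENNReal.ofReal (1 - c) := by
    intro x r hr
    obtain ⟨K0, hK0⟩ := eventually_atTop.1
      (H.tendsto_zero.eventually_le_const (show 0 < r / 2 by positivity))
    obtain ⟨S, hS, hsep, hsum⟩ := H.exists_separated_family hm hR hRd hdiv x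
      (show 0 < r / 2 by positivity) (max K K0)
    have hvolU : ENNReal.ofReal (c * (2 * r) ^ m) ≤ volume (Metric.closedBall x r ∩ U K) := by
      have h1 : volume (⋃ p ∈ S, Metric.ball p.1 (R p.2)) ≤
          volume (Metric.closedBall x r ∩ U K) := by
        refine measure_mono (Set.iUnion₂_subset fun p hp => ?_)
        obtain ⟨l, h1, h2, h3, h4, h5⟩ := hS p hp
        refine Set.subset_inter ?_ ?_
        · refine (Metric.ball_subset_ball' ?_).trans Metric.ball_subset_closedBall
          have := hK0 p.2 (by have := le_max_right K K0; omega)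
          linarith [hRd p.2]
        · rw [h1]
          refine Set.Subset.trans ?_ (Set.subset_biUnion_of_mem
            (u := fun l => ⋃ y ∈ P (l + 1) \ P l, Metric.ball y (R (l + 1)))
            (show l ∈ Set.Ici K from (le_max_left _ _).trans h2))
          exact Set.subset_biUnion_of_mem (u := fun y => Metric.ball y (R (l + 1)))
            (show p.1 ∈ P (l + 1) \ P l from ⟨h3, h4⟩)
      refine le_trans ?_ h1
      rw [measure_biUnion_finset (fun p hp p' hp' hne =>
          Metric.ball_disjoint_ball (hsep p hp p' hp' hne)) (fun _ _ => measurableSet_ball),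
        Finset.sum_congr rfl (fun p _ => Real.volume_pi_ball p.1 (hR p.2)),
        ← ENNReal.ofReal_sum_of_nonneg (fun p _ => by have := hR p.2; positivity)]
      refine ENNReal.ofReal_le_ofReal ?_
      simp only [mul_pow, Fintype.card_fin, ← Finset.mul_sum]
      calc c * (2 ^ m * r ^ m)
          = 2 ^ m * ((1 / (2 * Λ)) ^ m / (8 * 2 ^ m) * (r / 2) ^ m) := by
            rw [hc, div_pow r, div_pow 1 2, one_pow]; ring
        _ ≤ _ := by gcongr
    have hB : volume (Metric.closedBall x r) = ENNReal.ofReal ((2 * r) ^ m) := by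
      rw [Real.volume_pi_closedBall _ hr.le, Fintype.card_fin]
    have hadd := measure_inter_add_sdiff (μ := volume) (Metric.closedBall x r) hopen.measurableSet
    have hfin : volume (Metric.closedBall x r ∩ U K) ≠ ⊤ :=
      measure_ne_top_of_subset Set.inter_subset_left (by rw [hB]; exact ENNReal.ofReal_ne_top)
    have hdiff : volume ((U K)ᶜ ∩ Metric.closedBall x r) ≤
        ENNReal.ofReal ((1 - c) * (2 * r) ^ m) := by
      rw [Set.inter_comm, ← Set.sdiff_eq, ← ENNReal.add_sub_cancel_left hfin (b := volume (_ \ _)),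
        hadd, hB, sub_mul, one_mul, ENNReal.ofReal_sub _ (by positivity)]
      exact tsub_le_tsub_left hvolU _
    refine ENNReal.div_le_of_le_mul (hdiff.trans (le_of_eq ?_))
    rw [hB, ENNReal.ofReal_mul' (by positivity)]
  have hae := Besicovitch.ae_tendsto_measure_inter_div (volume : Measure (Fin m → ℝ)) (U K)ᶜ
  have hfalse : ∀ᵐ x ∂(volume : Measure (Fin m → ℝ)).restrict (U K)ᶜ, False := by
    filter_upwards [hae] with x hx
    have h1 : (1 : ENNReal) ≤ ENNReal.ofReal (1 - c) := by
      refine le_of_tendsto hx ?_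
      filter_upwards [self_mem_nhdsWithin] with r hr
      exact hbound x r hr
    rw [ENNReal.one_le_ofReal] at h1
    linarith
  simpa using hfalse

/-- Total weight of the members of the family `t` which meet `B`. -/
noncomputable def meetSum {ι X : Type*} (t : ι → Set X) (g : ι → ENNReal) (B : Set X) : ENNReal :=
  ∑' i, Set.indicator {i | (t i ∩ B).Nonempty} g i

/-- If every ball `closedBall (y c) (ρ c)` is met by sets `t i` of large total weight, then the
total volume of the enlarged disjoint balls is controlled: a set `t i` meeting two balls is larger
than the enlarged balls it meets, and a set meeting only one ball is counted once. -/
theorem sum_pow_le_meetSum {m : ℕ} {ι α : Type*} (t : ι → Set (Fin m → ℝ)) (r : ι → ℝ)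
    (hr : ∀ i, 0 < r i) (hdiam : ∀ i, ∀ u ∈ t i, ∀ v ∈ t i, dist u v ≤ r i)
    (g : ι → ENNReal) (S : Finset α) (y : α → Fin m → ℝ) (R ρ : α → ℝ)
    (hρ : ∀ c ∈ S, 0 < ρ c) (hρR : ∀ c ∈ S, 2 * ρ c ≤ R c)
    (hsep : ∀ c ∈ S, ∀ c' ∈ S, c ≠ c' → R c + R c' ≤ dist (y c) (y c'))
    (B : Set (Fin m → ℝ)) (hB : ∀ c ∈ S, Metric.closedBall (y c) (ρ c) ⊆ B) (E : ENNReal)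
    (hE : ∀ c ∈ S, ENNReal.ofReal (R c ^ m) ≤ E * meetSum t g (Metric.closedBall (y c) (ρ c))) :
    ∑ c ∈ S, ENNReal.ofReal (R c ^ m) ≤
      ENNReal.ofReal (4 ^ m) * meetSum t (fun i => ENNReal.ofReal (r i ^ m)) B + E * ∑' i, g i := by
  classical
  set I : α → ι → Prop := fun c i => (t i ∩ Metric.closedBall (y c) (ρ c)).Nonempty with hI
  set big : ι → Prop := fun i => ∃ c ∈ S, ∃ c' ∈ S, c ≠ c' ∧ I c i ∧ I c' i with hbig
  set F : α → ι → ENNReal := fun c i =>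
    (if I c i ∧ big i then ENNReal.ofReal (R c ^ m) else 0) +
      (if I c i ∧ ¬ big i then E * g i else 0) with hF
  have h1 : ∀ c ∈ S, ENNReal.ofReal (R c ^ m) ≤ ∑' i, F c i := by
    intro c hc
    by_cases h : ∃ i, I c i ∧ big i
    · obtain ⟨i, hi⟩ := h
      refine le_trans ?_ (ENNReal.le_tsum i)
      simp [hF, hi]
    · push Not at h
      refine (hE c hc).trans ?_
      rw [meetSum, ← ENNReal.tsum_mul_left]
      refine ENNReal.tsum_le_tsum fun i => ?_
      by_cases hi : I c i
      · have hi' : i ∈ {i | (t i ∩ Metric.closedBall (y c) (ρ c)).Nonempty} := hi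
        rw [Set.indicator_of_mem hi']
        simp [hF, hi, h i hi]
      · have hi' : i ∉ {i | (t i ∩ Metric.closedBall (y c) (ρ c)).Nonempty} := hi
        rw [Set.indicator_of_notMem hi']
        simp
  refine (Finset.sum_le_sum h1).trans ?_
  rw [← Summable.tsum_finsetSum (fun _ _ => ENNReal.summable), meetSum, ← ENNReal.tsum_mul_left,
    ← ENNReal.tsum_mul_left, ← ENNReal.tsum_add]
  refine ENNReal.tsum_le_tsum fun i => ?_
  have hr' := hr i
  by_cases hb : big i
  · refine le_trans ?_ le_self_add
    have hterm : ∀ c ∈ S, F c i = if I c i then ENNReal.ofReal (R c ^ m) else 0 := by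
      intro c _
      simp [hF, hb]
    rw [Finset.sum_congr rfl hterm, ← Finset.sum_filter]
    obtain ⟨c, hc, c', hc', hne, hIc, hIc'⟩ := id hb
    have hmem : i ∈ {i | (t i ∩ B).Nonempty} := hIc.mono (Set.inter_subset_inter_right _ (hB c hc))
    rw [Set.indicator_of_mem hmem, ← ENNReal.ofReal_mul (by positivity), ← mul_pow,
      ← ENNReal.ofReal_sum_of_nonneg (fun a ha => by
        have h1 := hρ a (Finset.mem_filter.1 ha).1
        have h2 := hρR a (Finset.mem_filter.1 ha).1
        exact pow_nonneg (by linarith) _)]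
    refine ENNReal.ofReal_le_ofReal ?_
    have hlarge : ∀ a ∈ S, ∀ b ∈ S, a ≠ b → I a i → I b i → R a ≤ 2 * r i := by
      intro a ha b hb hab ⟨u, hu, hu'⟩ ⟨v, hv, hv'⟩
      have h1 := hsep a ha b hb hab
      have h2 := hdiam i u hu v hv
      have h3 := dist_triangle4 (y a) u v (y b)
      rw [Metric.mem_closedBall] at hu' hv'
      rw [dist_comm (y a) u] at h3
      linarith [hρR a ha, hρR b hb, hρ b hb]
    have hlarge' : ∀ a ∈ S, I a i → R a ≤ 2 * r i := by
      intro a ha hIa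
      by_cases hac : a = c
      · subst hac
        exact hlarge a ha c' hc' hne hIa hIc'
      · exact hlarge a ha c hc hac hIa hIc
    obtain ⟨u0, hu0, -⟩ := hIc
    refine sum_pow_le_of_pairwise _ y R (fun a ha => ?_) (fun a ha b hb hab => ?_) u0 (4 * r i)
      (by positivity) (fun a ha => ?_)
    · have := hρ a (Finset.mem_filter.1 ha).1
      linarith [hρR a (Finset.mem_filter.1 ha).1]
    · exact hsep a (Finset.mem_filter.1 ha).1 b (Finset.mem_filter.1 hb).1 hab
    · obtain ⟨ha, hIa⟩ := Finset.mem_filter.1 ha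
      have h4 := hlarge' a ha hIa
      obtain ⟨u, hu, hu'⟩ := hIa
      have h2 := hdiam i u hu u0 hu0
      rw [Metric.mem_closedBall, dist_comm] at hu'
      have h3 := dist_triangle (y a) u u0
      linarith [hρR a ha]
  · refine le_trans ?_ le_add_self
    have hterm : ∀ c ∈ S, F c i = if I c i then E * g i else 0 := by
      intro c _
      simp [hF, hb]
    rw [Finset.sum_congr rfl hterm, ← Finset.sum_filter, Finset.sum_const, nsmul_eq_mul]
    have hcard : (S.filter (fun c => I c i)).card ≤ 1 := by
      rw [Finset.card_le_one]
      intro a ha b hb'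
      obtain ⟨ha, hIa⟩ := Finset.mem_filter.1 ha
      obtain ⟨hb', hIb⟩ := Finset.mem_filter.1 hb'
      by_contra hab
      exact hb ⟨a, ha, b, hb', hab, hIa, hIb⟩
    calc _ ≤ ((1 : ℕ) : ENNReal) * (E * g i) := by gcongr
      _ = E * g i := by simp

theorem meetSum_pow_le {m : ℕ} {s : ℝ} (hsm : s ≤ m) (hs0 : 0 ≤ s) {ι X : Type*} (t : ι → Set X)
    (r : ι → ℝ) (hr : ∀ i, 0 < r i) {κ ρ : ℝ} (hκ1 : κ < 1) (hκ : 0 < κ) (hρ : 0 < ρ) (B : Set X)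
    (h : meetSum t (fun i => ENNReal.ofReal (r i ^ s)) B ≤ ENNReal.ofReal (κ * ρ ^ s)) :
    meetSum t (fun i => ENNReal.ofReal (r i ^ m)) B ≤ ENNReal.ofReal (κ * ρ ^ m) := by
  have hle : ∀ i, (t i ∩ B).Nonempty → r i ≤ ρ := by
    intro i hi
    by_contra! hlt
    have h1 : ENNReal.ofReal (r i ^ s) ≤ ENNReal.ofReal (κ * ρ ^ s) := by
      refine le_trans ?_ h
      refine le_trans ?_ (ENNReal.le_tsum i)
      rw [Set.indicator_of_mem (show i ∈ {i | (t i ∩ B).Nonempty} from hi)]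
    have hpos : 0 < ρ ^ s := Real.rpow_pos_of_pos hρ s
    rw [ENNReal.ofReal_le_ofReal_iff (by positivity)] at h1
    have h2 := Real.rpow_le_rpow hρ.le hlt.le hs0
    nlinarith
  have hρm : ρ ^ m = ρ ^ ((m : ℝ) - s) * ρ ^ s := by
    rw [← Real.rpow_natCast, ← Real.rpow_add hρ]; congr 1; ring
  calc meetSum t (fun i => ENNReal.ofReal (r i ^ m)) B
      ≤ ENNReal.ofReal (ρ ^ ((m : ℝ) - s)) * meetSum t (fun i => ENNReal.ofReal (r i ^ s)) B := by
        rw [meetSum, meetSum, ← ENNReal.tsum_mul_left]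
        refine ENNReal.tsum_le_tsum fun i => ?_
        by_cases hi : (t i ∩ B).Nonempty
        · have hi' : i ∈ {i | (t i ∩ B).Nonempty} := hi
          rw [Set.indicator_of_mem hi', Set.indicator_of_mem hi',
            ← ENNReal.ofReal_mul (by positivity)]
          refine ENNReal.ofReal_le_ofReal ?_
          have hri := hr i
          have : r i ^ m = r i ^ ((m : ℝ) - s) * r i ^ s := by
            rw [← Real.rpow_natCast, ← Real.rpow_add hri]; congr 1; ring
          rw [this]
          gcongr
          exact hle i hi
        · have hi' : i ∉ {i | (t i ∩ B).Nonempty} := hi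
          rw [Set.indicator_of_notMem hi', Set.indicator_of_notMem hi']
          simp
    _ ≤ ENNReal.ofReal (ρ ^ ((m : ℝ) - s)) * ENNReal.ofReal (κ * ρ ^ s) := by gcongr
    _ = ENNReal.ofReal (κ * ρ ^ m) := by
        rw [← ENNReal.ofReal_mul (by positivity), hρm]; congr 1; ring

theorem not_summable_min {a : ℕ → ℝ} (h : ¬ Summable a) {c : ℝ} (hc : 0 < c) :
    ¬ Summable fun k => min (a k) c := by
  intro hs
  apply h
  have hev : ∀ᶠ k in atTop, min (a k) c < c := hs.tendsto_atTop_zero.eventually_lt_const hc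
  refine (summable_congr_atTop ?_).1 hs
  filter_upwards [hev] with k hk
  rcases min_lt_iff.1 hk with h1 | h1
  · exact min_eq_left h1.le
  · exact absurd h1 (lt_irrefl c)

/-- The fraction of a ball which the sets of a cover are allowed to occupy in `exists_child`. -/
noncomputable def occupancy (m : ℕ) (Λ : ℝ) : ℝ := (1 / (2 * Λ)) ^ m / (8 * 2 ^ m) / (4 * 8 ^ m)

theorem occupancy_pos (m : ℕ) {Λ : ℝ} (hΛ : 1 ≤ Λ) : 0 < occupancy m Λ := by
  unfold occupancy
  positivity

theorem occupancy_lt_one (m : ℕ) {Λ : ℝ} (hΛ : 1 ≤ Λ) : occupancy m Λ < 1 := by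
  unfold occupancy
  have h1 : (1 / (2 * Λ)) ^ m ≤ 1 := by
    refine pow_le_one₀ (by positivity) ?_
    rw [div_le_one (by positivity)]
    linarith
  have h2 : (1 : ℝ) ≤ 2 ^ m := one_le_pow₀ (by norm_num)
  have h3 : (1 : ℝ) ≤ 8 ^ m := one_le_pow₀ (by norm_num)
  rw [div_div, div_lt_one (by positivity)]
  nlinarith

/-- Radii `R k` with `R k ^ m` comparable to `ρ k ^ s`, truncated at `d k`, still have divergent
density. -/
theorem not_summable_truncated (hm : 0 < m) (H : DeloneTower P d θ Λ) (hd : ∀ k, d k ≤ 1)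
    {φ : ℕ → ℝ} (hφ : ∀ k, 0 < φ k) {s : ℝ} (hsm : s < m)
    (hdiv : ¬ Summable fun k => φ k ^ s / d k ^ m) {e : ℝ} (he : 0 < e) (he1 : e ≤ 1) :
    ¬ Summable fun k =>
      (min (e * min (φ k) (d k / 2) ^ (s / m)) (d k) / d k) ^ m := by
  have hm' : (0 : ℝ) < m := by exact_mod_cast hm
  have h1 : ¬ Summable fun k => e ^ m * (φ k ^ s / d k ^ m) := by
    rwa [summable_mul_left_iff (by positivity)]
  refine fun hsum => not_summable_min h1 (c := (e / 2) ^ m) (by positivity) ?_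
  refine Summable.of_nonneg_of_le (fun k => ?_) (fun k => ?_) hsum
  · have := hφ k
    have := H.pos k
    positivity
  · have hφk := hφ k
    have hdk := H.pos k
    rcases le_total (e * min (φ k) (d k / 2) ^ (s / m)) (d k) with h | h
    · rw [min_eq_left h, div_pow _ (d k), mul_pow, ← Real.rpow_mul_natCast (by positivity),
        div_mul_cancel₀ _ hm'.ne']
      rcases le_total (φ k) (d k / 2) with h' | h'
      · rw [min_eq_left h']
        refine (min_le_left _ _).trans (le_of_eq (by ring))
      · rw [min_eq_right h']
        refine (min_le_right _ _).trans ?_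
        rw [div_pow, mul_div_assoc, div_eq_mul_inv]
        gcongr
        rw [le_div_iff₀ (by positivity)]
        calc ((2 : ℝ) ^ m)⁻¹ * d k ^ m = (d k / 2) ^ (m : ℝ) := by
              rw [Real.rpow_natCast, div_pow]; ring
          _ ≤ (d k / 2) ^ s :=
              Real.rpow_le_rpow_of_exponent_ge (by positivity) (by linarith [hd k]) hsm.le
    · rw [min_eq_right h, div_self hdk.ne', one_pow]
      refine (min_le_right _ _).trans (pow_le_one₀ (by positivity) (by linarith))

/-- A ball in which the sets `t i` have small total volume contains a much smaller ball around a
new point of the tower with the same property. -/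
theorem exists_child (hm : 0 < m) (H : DeloneTower P d θ Λ) (hd : ∀ k, d k ≤ 1)
    {φ : ℕ → ℝ} (hφ : ∀ k, 0 < φ k) {s : ℝ} (hs0 : 0 ≤ s) (hsm : s < m)
    (hdiv : ¬ Summable fun k => φ k ^ s / d k ^ m) {ι : Type*} (t : ι → Set (Fin m → ℝ))
    (r : ι → ℝ) (hr : ∀ i, 0 < r i) (hdiam : ∀ i, ∀ u ∈ t i, ∀ v ∈ t i, dist u v ≤ r i)
    (hG : ∑' i, ENNReal.ofReal (r i ^ s) ≠ ⊤) {x : Fin m → ℝ} {ρ : ℝ} (hρ : 0 < ρ)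
    (hmeet : meetSum t (fun i => ENNReal.ofReal (r i ^ m)) (Metric.closedBall x ρ) ≤
      ENNReal.ofReal (occupancy m Λ * ρ ^ m)) (K : ℕ) :
    ∃ l, K ≤ l ∧ ∃ y ∈ P (l + 1), y ∉ P l ∧ ∃ ρ', 0 < ρ' ∧ ρ' ≤ φ (l + 1) ∧ ρ' ≤ d (l + 1) ∧
      Metric.closedBall y ρ' ⊆ Metric.closedBall x ρ ∧
      meetSum t (fun i => ENNReal.ofReal (r i ^ m)) (Metric.closedBall y ρ') ≤
        ENNReal.ofReal (occupancy m Λ * ρ' ^ m) := by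
  have hm' : (0 : ℝ) < m := by exact_mod_cast hm
  have hΛ := H.one_le
  have hκ := occupancy_pos m hΛ
  set κ := occupancy m Λ with hκdef
  set c : ℝ := (1 / (2 * Λ)) ^ m / (8 * 2 ^ m) with hc
  have hcpos : 0 < c := by positivity
  obtain ⟨G, hG0, hGeq⟩ : ∃ G : ℝ, 0 ≤ G ∧ ∑' i, ENNReal.ofReal (r i ^ s) = ENNReal.ofReal G :=
    ⟨_, ENNReal.toReal_nonneg, (ENNReal.ofReal_toReal hG).symm⟩
  set σ := ρ / 2 with hσdef
  have hσ : 0 < σ := by positivity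
  set e : ℝ := min 1 (κ * (c * σ ^ m) / (4 * (G + 1))) with hedef
  have he : 0 < e := lt_min one_pos (by positivity)
  have he1 : e ≤ 1 := min_le_left _ _
  have heG : e ^ m / κ * G ≤ c * σ ^ m / 4 := by
    have h1 : e ^ m ≤ e := pow_le_of_le_one he.le he1 hm.ne'
    have h2 : e * (4 * (G + 1)) ≤ κ * (c * σ ^ m) := by
      rw [← le_div_iff₀ (by positivity)]
      exact min_le_right _ _
    rw [div_mul_eq_mul_div, div_le_iff₀ hκ]
    nlinarith [mul_le_mul_of_nonneg_right h1 hG0]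
  set q : ℕ → ℝ := fun k => min (φ k) (d k / 2) with hq
  have hqpos : ∀ k, 0 < q k := fun k => lt_min (hφ k) (half_pos (H.pos k))
  set R : ℕ → ℝ := fun k => min (e * q k ^ (s / m)) (d k) with hR
  have hRpos : ∀ k, 0 < R k := fun k =>
    lt_min (mul_pos he (Real.rpow_pos_of_pos (hqpos k) _)) (H.pos k)
  have hRm : ∀ k, R k ^ m ≤ e ^ m * q k ^ s := by
    intro k
    calc R k ^ m ≤ (e * q k ^ (s / m)) ^ m := by
          have := (hRpos k).le
          gcongr
          exact min_le_left _ _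
      _ = e ^ m * q k ^ s := by
          rw [mul_pow, ← Real.rpow_mul_natCast (hqpos k).le, div_mul_cancel₀ _ hm'.ne']
  have hq0 : Tendsto q atTop (nhds 0) := by
    refine squeeze_zero (fun k => (hqpos k).le) (fun k => ?_) H.tendsto_zero
    exact (min_le_right _ _).trans (by linarith [H.pos k])
  have hqlim : Tendsto (fun k => q k ^ (1 - s / m)) atTop (nhds 0) := by
    have hpos : 0 < 1 - s / m := by
      rw [sub_pos, div_lt_one hm']
      exact hsm
    have := (Real.continuousAt_rpow_const 0 (1 - s / m) (Or.inr hpos.le)).tendsto.comp hq0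
    rwa [Real.zero_rpow hpos.ne'] at this
  have hev : ∀ᶠ k in atTop, d k ≤ ρ ∧ q k ^ (1 - s / m) ≤ e / 2 :=
    (H.tendsto_zero.eventually_le_const hρ).and (hqlim.eventually_le_const (by positivity))
  obtain ⟨K₀, hK₀⟩ := eventually_atTop.1 hev
  have h2q : ∀ k, K₀ ≤ k → 2 * q k ≤ R k := by
    intro k hk
    refine le_min ?_ ?_
    · have h1 : q k = q k ^ (1 - s / m) * q k ^ (s / m) := by
        rw [← Real.rpow_add (hqpos k)]
        simp
      have h2 := mul_le_mul_of_nonneg_right (hK₀ k hk).2 (Real.rpow_nonneg (hqpos k).le (s / m))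
      rw [← h1] at h2
      linarith
    · have := min_le_right (φ k) (d k / 2)
      simp only [hq]
      linarith
  obtain ⟨S, hSmem, hSsep, hSsum⟩ := exists_separated_family hm H hRpos (fun k => min_le_right _ _)
    (not_summable_truncated hm H hd hφ hsm hdiv he he1) x hσ (max K K₀)
  by_contra hcon
  push Not at hcon
  have hball : ∀ p ∈ S, Metric.closedBall p.1 (q p.2) ⊆ Metric.closedBall x ρ := by
    intro p hp
    obtain ⟨l, hl, hKl, -, -, hdist⟩ := hSmem p hp
    have h1 := (hK₀ p.2 (by rw [hl]; have := (le_max_right _ _).trans hKl; lia)).1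
    refine Metric.closedBall_subset_closedBall' ?_
    have : q p.2 ≤ d p.2 / 2 := min_le_right _ _
    rw [hσdef] at hdist
    linarith
  have hlarge : ∀ p ∈ S, ENNReal.ofReal (R p.2 ^ m) ≤ ENNReal.ofReal (e ^ m / κ) *
      meetSum t (fun i => ENNReal.ofReal (r i ^ s)) (Metric.closedBall p.1 (q p.2)) := by
    intro p hp
    obtain ⟨l, hl, hKl, hy, hy', hdist⟩ := hSmem p hp
    have h1 := hcon l ((le_max_left _ _).trans hKl) p.1 hy hy' (q p.2) (hqpos _)
      (by rw [hl]; exact min_le_left _ _)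
      (by rw [hl]; exact (min_le_right _ _).trans (by linarith [H.pos (l + 1)])) (hball p hp)
    have h2 : ENNReal.ofReal (κ * q p.2 ^ s) ≤
        meetSum t (fun i => ENNReal.ofReal (r i ^ s)) (Metric.closedBall p.1 (q p.2)) := by
      by_contra! hlt
      exact absurd (meetSum_pow_le hsm.le hs0 t r hr (occupancy_lt_one m hΛ) hκ (hqpos _) _ hlt.le)
        (not_le.2 h1)
    calc ENNReal.ofReal (R p.2 ^ m) ≤ ENNReal.ofReal (e ^ m / κ * (κ * q p.2 ^ s)) := by
          refine ENNReal.ofReal_le_ofReal ((hRm _).trans (le_of_eq ?_))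
          field_simp
      _ = ENNReal.ofReal (e ^ m / κ) * ENNReal.ofReal (κ * q p.2 ^ s) :=
          ENNReal.ofReal_mul (by positivity)
      _ ≤ _ := by gcongr
  have hmain := sum_pow_le_meetSum t r hr hdiam (fun i => ENNReal.ofReal (r i ^ s)) S Prod.fst
    (fun p => R p.2) (fun p => q p.2) (fun p _ => hqpos _)
    (fun p hp => h2q _ (by
      obtain ⟨l, hl, hKl, -⟩ := hSmem p hp
      have := (le_max_right _ _).trans hKl
      lia)) hSsep _ hball _ hlarge
  rw [← ENNReal.ofReal_sum_of_nonneg (fun p _ => pow_nonneg (hRpos _).le _), hGeq,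
    ← ENNReal.ofReal_mul (by positivity)] at hmain
  have h4 : (4 : ℝ) ^ m * (κ * ρ ^ m) = c * σ ^ m / 4 := by
    have h8 : (8 : ℝ) ^ m = 4 ^ m * 2 ^ m := by rw [← mul_pow]; norm_num
    have hκc : κ = c / (4 * 8 ^ m) := rfl
    rw [hκc, hσdef, div_pow, h8]
    field_simp
  have hfin : ENNReal.ofReal (c * σ ^ m) ≤ ENNReal.ofReal (c * σ ^ m / 2) := by
    calc ENNReal.ofReal (c * σ ^ m) ≤ _ := ENNReal.ofReal_le_ofReal hSsum
      _ ≤ _ := hmain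
      _ ≤ ENNReal.ofReal (4 ^ m) * ENNReal.ofReal (κ * ρ ^ m) +
          ENNReal.ofReal (e ^ m / κ * G) := by gcongr
      _ = ENNReal.ofReal (c * σ ^ m / 4 + e ^ m / κ * G) := by
          rw [← ENNReal.ofReal_mul (by positivity), h4,
            ← ENNReal.ofReal_add (by positivity) (by positivity)]
      _ ≤ ENNReal.ofReal (c * σ ^ m / 2) := by
          refine ENNReal.ofReal_le_ofReal ?_
          linarith
  rw [ENNReal.ofReal_le_ofReal_iff (by positivity)] at hfin
  have : 0 < c * σ ^ m := by positivity
  linarith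

/-- A set of finite `s`-dimensional measure has covers of finite `s`-weight and arbitrarily small
`m`-weight, for `s < m`. -/
theorem exists_cover_of_hausdorffMeasure_ne_top {X : Type*} [MetricSpace X] [MeasurableSpace X]
    [BorelSpace X] {s : ℝ} {m : ℕ} (hs0 : 0 ≤ s) (hsm : s < m) {E : Set X} (hE : μH[s] E ≠ ⊤)
    {ε : ℝ} (hε : 0 < ε) :
    ∃ (ι : Type) (t : ι → Set X) (r : ι → ℝ), E ⊆ ⋃ i, t i ∧ (∀ i, 0 < r i) ∧
      (∀ i, ∀ u ∈ t i, ∀ v ∈ t i, dist u v ≤ r i) ∧ ∑' i, ENNReal.ofReal (r i ^ s) ≠ ⊤ ∧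
      ∑' i, ENNReal.ofReal (r i ^ m) ≤ ENNReal.ofReal ε := by
  set M : ℝ := (μH[s] E).toReal with hM
  have hM0 : 0 ≤ M := ENNReal.toReal_nonneg
  have hms : 0 < (m : ℝ) - s := sub_pos.2 hsm
  obtain ⟨δ, hδ, hδε⟩ : ∃ δ : ℝ, 0 < δ ∧ (2 * δ) ^ ((m : ℝ) - s) * (M + 2) ≤ ε := by
    have hlim : Tendsto (fun δ : ℝ => (2 * δ) ^ ((m : ℝ) - s) * (M + 2)) (nhds 0) (nhds 0) := by
      have : ContinuousAt (fun δ : ℝ => (2 * δ) ^ ((m : ℝ) - s) * (M + 2)) 0 :=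
        ((continuousAt_id.const_mul 2).rpow_const (Or.inr hms.le)).mul_const _
      have h := this.tendsto
      simpa [Real.zero_rpow hms.ne'] using h
    have h1 : ∀ᶠ δ in nhdsWithin (0 : ℝ) (Set.Ioi 0), (2 * δ) ^ ((m : ℝ) - s) * (M + 2) ≤ ε :=
      nhdsWithin_le_nhds (hlim.eventually_le_const hε)
    obtain ⟨δ, h2, h3⟩ := (h1.and self_mem_nhdsWithin).exists
    exact ⟨δ, h3, h2⟩
  have hlt : μH[s] E < ENNReal.ofReal (M + 1) := by
    rw [← ENNReal.ofReal_toReal hE]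
    exact (ENNReal.ofReal_lt_ofReal_iff (by positivity)).2 (by linarith)
  rw [Measure.hausdorffMeasure_apply] at hlt
  have hlt' := (le_iSup₂ (f := fun (r : ENNReal) (_ : 0 < r) =>
    ⨅ (t : ℕ → Set X) (_ : E ⊆ ⋃ n, t n) (_ : ∀ n, Metric.ediam (t n) ≤ r),
      ∑' n, ⨆ _ : (t n).Nonempty, Metric.ediam (t n) ^ s) (ENNReal.ofReal δ)
        (ENNReal.ofReal_pos.2 hδ)).trans_lt hlt
  simp only [iInf_lt_iff] at hlt'
  obtain ⟨t, hEt, htδ, hsum⟩ := hlt'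
  obtain ⟨w, hw, hw1⟩ := ENNReal.exists_pos_sum_of_countable one_ne_zero ℕ
  have hex : ∀ n, ∃ ρ : ℝ, 0 < ρ ∧ ρ ≤ 2 * δ ∧ Metric.ediam (t n) ≤ ENNReal.ofReal ρ ∧
      ENNReal.ofReal (ρ ^ s) ≤ Metric.ediam (t n) ^ s + w n := by
    intro n
    set a : ℝ := (Metric.ediam (t n)).toReal with ha
    have hne : Metric.ediam (t n) ≠ ⊤ := ((htδ n).trans_lt ENNReal.ofReal_lt_top).ne
    have haeq : Metric.ediam (t n) = ENNReal.ofReal a := (ENNReal.ofReal_toReal hne).symm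
    have ha0 : 0 ≤ a := ENNReal.toReal_nonneg
    have haδ : a ≤ δ := ENNReal.toReal_le_of_le_ofReal hδ.le (htδ n)
    have h1 : ∀ᶠ ρ in nhdsWithin a (Set.Ioi a), ρ ^ s < a ^ s + w n :=
      nhdsWithin_le_nhds
        ((Real.continuousAt_rpow_const a s (Or.inr hs0)).tendsto.eventually_lt_const
          (lt_add_of_pos_right _ (hw n)))
    have h2 : ∀ᶠ ρ in nhdsWithin a (Set.Ioi a), ρ < 2 * δ :=
      nhdsWithin_le_nhds (eventually_lt_nhds (by linarith))
    obtain ⟨ρ, ⟨h3, h4⟩, h5⟩ := ((h1.and h2).and self_mem_nhdsWithin).exists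
    have h5' : a < ρ := h5
    refine ⟨ρ, by linarith, h4.le, ?_, ?_⟩
    · rw [haeq]
      exact ENNReal.ofReal_le_ofReal h5'.le
    · rw [haeq, ENNReal.ofReal_rpow_of_nonneg ha0 hs0, ← ENNReal.ofReal_coe_nnreal,
        ← ENNReal.ofReal_add (by positivity) (by positivity)]
      exact ENNReal.ofReal_le_ofReal h3.le
  choose ρ hρ hρδ hρt hρs using hex
  have hG : ∑' i : {n // (t n).Nonempty}, ENNReal.ofReal (ρ i ^ s) ≤ ENNReal.ofReal (M + 2) := by
    calc ∑' i : {n // (t n).Nonempty}, ENNReal.ofReal (ρ i ^ s)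
        ≤ ∑' i : {n // (t n).Nonempty}, ((⨆ _ : (t i).Nonempty, Metric.ediam (t i) ^ s) + w i) := by
          refine ENNReal.tsum_le_tsum fun i => (hρs i).trans ?_
          rw [iSup_pos i.2]
      _ ≤ ∑' n, ((⨆ _ : (t n).Nonempty, Metric.ediam (t n) ^ s) + w n) :=
          ENNReal.tsum_comp_le_tsum_of_injective Subtype.val_injective _
      _ ≤ ENNReal.ofReal (M + 1) + 1 := by
          rw [ENNReal.tsum_add]
          gcongr
      _ = ENNReal.ofReal (M + 2) := by
          rw [← ENNReal.ofReal_one, ← ENNReal.ofReal_add (by positivity) zero_le_one]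
          congr 1
          ring
  refine ⟨{n // (t n).Nonempty}, fun i => t i, fun i => ρ i, fun z hz => ?_, fun i => hρ i,
    fun i u hu v hv => ?_, (hG.trans_lt ENNReal.ofReal_lt_top).ne, ?_⟩
  · obtain ⟨n, hn⟩ := Set.mem_iUnion.1 (hEt hz)
    exact Set.mem_iUnion.2 ⟨⟨n, z, hn⟩, hn⟩
  · rw [← ENNReal.ofReal_le_ofReal_iff (hρ i).le, ← edist_dist]
    exact (Metric.edist_le_ediam_of_mem hu hv).trans (hρt i)
  · calc ∑' i : {n // (t n).Nonempty}, ENNReal.ofReal (ρ i ^ m)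
        ≤ ∑' i : {n // (t n).Nonempty},
            ENNReal.ofReal ((2 * δ) ^ ((m : ℝ) - s)) * ENNReal.ofReal (ρ i ^ s) := by
          refine ENNReal.tsum_le_tsum fun i => ?_
          rw [← ENNReal.ofReal_mul (by positivity)]
          refine ENNReal.ofReal_le_ofReal ?_
          have hρi := hρ i
          have : ρ i ^ m = ρ i ^ ((m : ℝ) - s) * ρ i ^ s := by
            rw [← Real.rpow_natCast, ← Real.rpow_add hρi]; congr 1; ring
          rw [this]
          gcongr
          exact hρδ i
      _ = ENNReal.ofReal ((2 * δ) ^ ((m : ℝ) - s)) *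
            ∑' i : {n // (t n).Nonempty}, ENNReal.ofReal (ρ i ^ s) := ENNReal.tsum_mul_left
      _ ≤ ENNReal.ofReal ((2 * δ) ^ ((m : ℝ) - s)) * ENNReal.ofReal (M + 2) := by gcongr
      _ ≤ ENNReal.ofReal ε := by
          rw [← ENNReal.ofReal_mul (by positivity)]
          exact ENNReal.ofReal_le_ofReal hδε

/-- A family of sets of finite `s`-weight and small `m`-weight does not cover the part of the limit
set inside a given ball. -/
theorem exists_mem_limitSet_notMem (hm : 0 < m) (H : DeloneTower P d θ Λ) (hd : ∀ k, d k ≤ 1)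
    {φ : ℕ → ℝ} (hφ : ∀ k, 0 < φ k) {s : ℝ} (hs0 : 0 ≤ s) (hsm : s < m)
    (hdiv : ¬ Summable fun k => φ k ^ s / d k ^ m) {ι : Type*} (t : ι → Set (Fin m → ℝ))
    (r : ι → ℝ) (hr : ∀ i, 0 < r i) (hdiam : ∀ i, ∀ u ∈ t i, ∀ v ∈ t i, dist u v ≤ r i)
    (hG : ∑' i, ENNReal.ofReal (r i ^ s) ≠ ⊤) (x : Fin m → ℝ) {ρ : ℝ} (hρ : 0 < ρ)
    (hsmall : ∑' i, ENNReal.ofReal (r i ^ m) ≤ ENNReal.ofReal (occupancy m Λ * ρ ^ m)) :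
    ∃ z ∈ limitSet P φ ∩ Metric.closedBall x ρ, ∀ i, z ∉ t i := by
  set good : (Fin m → ℝ) × ℝ → Prop := fun b => 0 < b.2 ∧
    meetSum t (fun i => ENNReal.ofReal (r i ^ m)) (Metric.closedBall b.1 b.2) ≤
      ENNReal.ofReal (occupancy m Λ * b.2 ^ m) with hgood
  have hstart : good (x, ρ) := ⟨hρ, le_trans
    (ENNReal.tsum_le_tsum fun i => Set.indicator_le_self _ _ i) hsmall⟩
  have hstep : ∀ (K : ℕ) (b : {b // good b}), ∃ b' : {b // good b},
      Metric.closedBall b'.1.1 b'.1.2 ⊆ Metric.closedBall b.1.1 b.1.2 ∧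
      ∃ l, K ≤ l ∧ b'.1.1 ∈ P (l + 1) ∧ b'.1.1 ∉ P l ∧ b'.1.2 ≤ φ (l + 1) ∧
        b'.1.2 ≤ d (l + 1) := by
    rintro K ⟨⟨y, τ⟩, hτ, hmeet⟩
    obtain ⟨l, hKl, y', hy', hy'', τ', hτ', h1, h2, h3, h4⟩ :=
      exists_child hm H hd hφ hs0 hsm hdiv t r hr hdiam hG hτ hmeet K
    exact ⟨⟨(y', τ'), hτ', h4⟩, h3, l, hKl, hy', hy'', h1, h2⟩
  choose f hfsub hf using hstep
  let b : ℕ → {b // good b} := fun n => Nat.rec ⟨(x, ρ), hstart⟩ (fun k bk => f k bk) n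
  have hb : ∀ n, b (n + 1) = f n (b n) := fun n => rfl
  set B : ℕ → Set (Fin m → ℝ) := fun n => Metric.closedBall (b n).1.1 (b n).1.2 with hB
  obtain ⟨z, hz⟩ := IsCompact.nonempty_iInter_of_sequence_nonempty_isCompact_isClosed B
    (fun n => by
      simp only [hB]
      rw [hb]
      exact hfsub n (b n))
    (fun n => ⟨(b n).1.1, Metric.mem_closedBall_self (b n).2.1.le⟩)
    (isCompact_closedBall _ _) (fun n => Metric.isClosed_closedBall)
  have hz' : ∀ n, dist z (b n).1.1 ≤ (b n).1.2 := fun n => Set.mem_iInter.1 hz n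
  refine ⟨z, ⟨fun K => ?_, hz' 0⟩, fun i hzi => ?_⟩
  · obtain ⟨l, hKl, h1, h2, h3, -⟩ := hf K (b K)
    refine ⟨l, hKl, _, h1, h2, ?_⟩
    have := hz' (K + 1)
    rw [hb] at this
    exact this.trans h3
  · have hκ := occupancy_pos m H.one_le
    have hκ1 := occupancy_lt_one m H.one_le
    have hle : ∀ n, r i ≤ (b n).1.2 := by
      intro n
      have hpos := (b n).2.1
      by_contra! hlt
      have h1 : ENNReal.ofReal (r i ^ m) ≤
          ENNReal.ofReal (occupancy m Λ * (b n).1.2 ^ m) := by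
        refine le_trans ?_ (b n).2.2
        refine le_trans ?_ (ENNReal.le_tsum i)
        rw [Set.indicator_of_mem (show i ∈ {i | (t i ∩ Metric.closedBall _ _).Nonempty} from
          ⟨z, hzi, hz' n⟩)]
      rw [ENNReal.ofReal_le_ofReal_iff (by positivity)] at h1
      have h2 : (b n).1.2 ^ m ≤ r i ^ m := pow_le_pow_left₀ hpos.le hlt.le m
      have h3 : 0 < (b n).1.2 ^ m := by positivity
      nlinarith
    obtain ⟨K, hK⟩ := eventually_atTop.1 (H.tendsto_zero.eventually_lt_const (hr i))
    obtain ⟨l, hKl, -, -, -, h4⟩ := hf K (b K)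
    have h5 := hle (K + 1)
    rw [hb] at h5
    linarith [hK (l + 1) (by lia)]

theorem hausdorffMeasure_limitSet_inter (hm : 0 < m) (H : DeloneTower P d θ Λ)
    (hd : ∀ k, d k ≤ 1) {φ : ℕ → ℝ} (hφ : ∀ k, 0 < φ k) {s : ℝ} (hs0 : 0 ≤ s) (hsm : s < m)
    (hdiv : ¬ Summable fun k => φ k ^ s / d k ^ m) (x : Fin m → ℝ) {ρ : ℝ} (hρ : 0 < ρ) :
    μH[s] (limitSet P φ ∩ Metric.closedBall x ρ) = ⊤ := by
  by_contra hE
  have hκ := occupancy_pos m H.one_le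
  obtain ⟨ι, t, r, hcov, hr, hdiam, hG, hsmall⟩ := exists_cover_of_hausdorffMeasure_ne_top hs0 hsm
    hE (ε := occupancy m Λ * ρ ^ m) (by positivity)
  obtain ⟨z, hz, hzt⟩ := exists_mem_limitSet_notMem hm H hd hφ hs0 hsm hdiv t r hr hdiam hG x hρ
    hsmall
  obtain ⟨i, hi⟩ := Set.mem_iUnion.1 (hcov hz)
  exact hzt i hi

end DeloneTower

/-- The real vector with given integer coordinates. -/
abbrev intVec {k : ℕ} (q : Fin k → ℤ) : Fin k → ℝ := fun j => (q j : ℝ)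

theorem intVec_zero {k : ℕ} : intVec (0 : Fin k → ℤ) = 0 :=
  funext fun _ => Int.cast_zero

theorem intVec_sub {k : ℕ} (p q : Fin k → ℤ) : intVec (p - q) = intVec p - intVec q :=
  funext fun _ => Int.cast_sub _ _

theorem intVec_add {k : ℕ} (p q : Fin k → ℤ) : intVec (p + q) = intVec p + intVec q :=
  funext fun _ => Int.cast_add _ _

theorem intVec_nsmul {k : ℕ} (j : ℕ) (q : Fin k → ℤ) : intVec (j • q) = (j : ℝ) • intVec q :=
  funext fun i => by simp [intVec]

theorem one_le_norm_intVec {k : ℕ} {q : Fin k → ℤ} (hq : q ≠ 0) : 1 ≤ ‖intVec q‖ := by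
  obtain ⟨j, hj⟩ := Function.ne_iff.1 hq
  refine le_trans ?_ (norm_le_pi_norm (intVec q) j)
  rw [Real.norm_eq_abs]
  exact_mod_cast Int.one_le_abs hj

theorem bddBelow_range_norm_sub {k : ℕ} (x : Fin k → ℝ) :
    BddBelow (Set.range fun p : Fin k → ℤ => ‖x - intVec p‖) :=
  ⟨0, by rintro _ ⟨p, rfl⟩; exact norm_nonneg _⟩

theorem intDist_le {k : ℕ} (x : Fin k → ℝ) (p : Fin k → ℤ) : intDist x ≤ ‖x - intVec p‖ :=
  ciInf_le (bddBelow_range_norm_sub x) p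

theorem intDist_nonneg {k : ℕ} (x : Fin k → ℝ) : 0 ≤ intDist x :=
  Real.iInf_nonneg fun _ => norm_nonneg _

theorem exists_norm_sub_lt_of_intDist_lt {k : ℕ} {x : Fin k → ℝ} {ε : ℝ} (h : intDist x < ε) :
    ∃ p : Fin k → ℤ, ‖x - intVec p‖ < ε :=
  exists_lt_of_ciInf_lt h

theorem intDist_nsmul_eq_zero {k : ℕ} {x : Fin k → ℝ} (h : intDist x = 0) (j : ℕ) :
    intDist ((j : ℝ) • x) = 0 := by
  refine le_antisymm (le_of_forall_pos_lt_add fun ε hε => ?_) (intDist_nonneg _)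
  obtain ⟨p, hp⟩ := exists_norm_sub_lt_of_intDist_lt (x := x) (ε := ε / (j + 1))
    (by rw [h]; positivity)
  have h2 := intDist_le ((j : ℝ) • x) (j • p)
  rw [intVec_nsmul, ← smul_sub, norm_smul, Real.norm_natCast] at h2
  rw [lt_div_iff₀ (by positivity)] at hp
  nlinarith [norm_nonneg (x - intVec p)]

theorem BadlyApproximable.exists_const {m n : ℕ} {A : Matrix (Fin m) (Fin n) ℝ}
    (hA : BadlyApproximable m n A) :
    ∃ c : ℝ, 0 < c ∧ c ≤ 1 ∧ ∀ q : Fin n → ℤ, q ≠ 0 → ∀ p : Fin m → ℤ,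
      c ≤ ‖intVec q‖ ^ ((n : ℝ) / m) * ‖A.mulVec (intVec q) - intVec p‖ := by
  set f : (Fin n → ℤ) → ℝ := fun q =>
    ‖intVec q‖ ^ ((n : ℝ) / m) * intDist (A.mulVec (intVec q)) with hf
  have hlim : 0 < liminf f cofinite := hA
  rw [liminf_eq] at hlim
  obtain ⟨a, ha, ha0⟩ : ∃ a ∈ {a | ∀ᶠ q in cofinite, a ≤ f q}, 0 < a := by
    by_contra! hcon
    exact absurd (Real.sSup_nonpos hcon) (not_le.2 hlim)
  have hfin : {q | ¬ a ≤ f q}.Finite := ha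
  have hpos : ∀ q : Fin n → ℤ, q ≠ 0 → 0 < f q := by
    intro q hq
    have hq1 := one_le_norm_intVec hq
    refine mul_pos (Real.rpow_pos_of_pos (by linarith) _)
      (lt_of_le_of_ne (intDist_nonneg _) fun h0 => ?_)
    refine Set.infinite_of_injective_forall_mem (f := fun j : ℕ => j • q) (fun j j' hjj => ?_)
      (fun j => ?_) hfin
    · obtain ⟨i, hi⟩ := Function.ne_iff.1 hq
      have := congrFun hjj i
      have hi' : q i ≠ 0 := hi
      simpa [hi'] using this
    · have h2 : f (j • q) = 0 := by
        simp only [hf]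
        rw [intVec_nsmul, Matrix.mulVec_smul, intDist_nsmul_eq_zero h0.symm, mul_zero]
      simp only [Set.mem_ofPred_eq, h2, not_le]
      exact ha0
  obtain ⟨b, hb, hbf⟩ : ∃ b : ℝ, 0 < b ∧ ∀ q ∈ {q | ¬ a ≤ f q}, q ≠ 0 → b ≤ f q := by
    rcases (hfin.toFinset.filter (· ≠ 0)).eq_empty_or_nonempty with h | h
    · refine ⟨1, one_pos, fun q hq hq0 => ?_⟩
      have : q ∈ hfin.toFinset.filter (· ≠ 0) := by simpa [hq0] using hq
      simp [h] at this
    · obtain ⟨q₀, hq₀, hmin⟩ := Finset.exists_min_image _ f h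
      refine ⟨f q₀, hpos _ (Finset.mem_filter.1 hq₀).2, fun q hq hq0 => hmin q ?_⟩
      simpa [hq0] using hq
  refine ⟨min 1 (min a b), by positivity, min_le_left _ _, fun q hq p => ?_⟩
  have hle : min 1 (min a b) ≤ f q := by
    refine (min_le_right _ _).trans ?_
    by_cases h : a ≤ f q
    · exact (min_le_left _ _).trans h
    · exact (min_le_right _ _).trans (hbf q h hq)
  refine hle.trans ?_
  simp only [hf]
  gcongr
  exact intDist_le _ _

/-- The points `A q - p` with `‖q‖ ≤ M`. -/
def affineOrbit {m n : ℕ} (A : Matrix (Fin m) (Fin n) ℝ) (M : ℝ) : Set (Fin m → ℝ) :=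
  {y | ∃ (q : Fin n → ℤ) (p : Fin m → ℤ), ‖intVec q‖ ≤ M ∧ y = A.mulVec (intVec q) - intVec p}

theorem norm_mulVec_sub_ge {m n : ℕ} {A : Matrix (Fin m) (Fin n) ℝ} {c : ℝ}
    (hc : ∀ q : Fin n → ℤ, q ≠ 0 → ∀ p : Fin m → ℤ,
      c ≤ ‖intVec q‖ ^ ((n : ℝ) / m) * ‖A.mulVec (intVec q) - intVec p‖)
    {q : Fin n → ℤ} (hq : q ≠ 0) (p : Fin m → ℤ) {M : ℝ} (hM : ‖intVec q‖ ≤ M) :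
    c * M ^ (-((n : ℝ) / m)) ≤ ‖A.mulVec (intVec q) - intVec p‖ := by
  have h1 := one_le_norm_intVec hq
  have hM0 : 0 < M := by linarith
  rw [Real.rpow_neg hM0.le, ← div_eq_mul_inv, div_le_iff₀ (Real.rpow_pos_of_pos hM0 _), mul_comm]
  refine (hc q hq p).trans ?_
  gcongr

theorem affineOrbit_separated {m n : ℕ} {A : Matrix (Fin m) (Fin n) ℝ} {c : ℝ} (hc0 : 0 < c)
    (hc1 : c ≤ 1) (hc : ∀ q : Fin n → ℤ, q ≠ 0 → ∀ p : Fin m → ℤ,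
      c ≤ ‖intVec q‖ ^ ((n : ℝ) / m) * ‖A.mulVec (intVec q) - intVec p‖)
    {M : ℝ} (hM : 1 ≤ M) {y z : Fin m → ℝ} (hy : y ∈ affineOrbit A M) (hz : z ∈ affineOrbit A M)
    (hyz : y ≠ z) : c * (2 * M) ^ (-((n : ℝ) / m)) ≤ dist y z := by
  obtain ⟨q, p, hq, rfl⟩ := hy
  obtain ⟨q', p', hq', rfl⟩ := hz
  rw [dist_eq_norm, sub_sub_sub_comm, ← Matrix.mulVec_sub, ← intVec_sub, ← intVec_sub]
  by_cases h : q = q'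
  · subst h
    have hp : p - p' ≠ 0 := by
      rintro h
      exact hyz (by rw [sub_eq_zero.1 h])
    have h1 := one_le_norm_intVec hp
    rw [sub_self, intVec_zero, Matrix.mulVec_zero, zero_sub, norm_neg]
    have h2 : (2 * M) ^ (-((n : ℝ) / m)) ≤ 1 :=
      Real.rpow_le_one_of_one_le_of_nonpos (by linarith) (by rw [neg_nonpos]; positivity)
    nlinarith
  · refine norm_mulVec_sub_ge hc (sub_ne_zero.2 h) _ ?_
    rw [intVec_sub]
    refine (norm_sub_le _ _).trans (by linarith)

/-- Distance from `x` to the orbit points `A q - p`, where `x - (A q - p)` is measured in units of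
`d` and `q` in units of `N`. -/
noncomputable def orbitGap {m n : ℕ} (A : Matrix (Fin m) (Fin n) ℝ) (d N : ℝ) (x : Fin m → ℝ) : ℝ :=
  Metric.infDist (d⁻¹ • x, (0 : Fin n → ℝ))
    (Set.range fun v : (Fin n → ℤ) × (Fin m → ℤ) =>
      (d⁻¹ • (A.mulVec (intVec v.1) - intVec v.2), N⁻¹ • intVec v.1))

theorem orbitGap_zero {m n : ℕ} (A : Matrix (Fin m) (Fin n) ℝ) (d N : ℝ) :
    orbitGap A d N 0 = 0 := by
  refine Metric.infDist_zero_of_mem ⟨(0, 0), ?_⟩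
  simp [intVec_zero]

theorem continuous_orbitGap {m n : ℕ} (A : Matrix (Fin m) (Fin n) ℝ) (d N : ℝ) :
    Continuous (orbitGap A d N) :=
  (Metric.continuous_infDist_pt _).comp (by fun_prop)

theorem exists_of_orbitGap_lt {m n : ℕ} {A : Matrix (Fin m) (Fin n) ℝ} {d N r : ℝ} (hd : 0 < d)
    (hN : 0 < N) {x : Fin m → ℝ} (h : orbitGap A d N x < r) :
    ∃ (q : Fin n → ℤ) (p : Fin m → ℤ), ‖x - (A.mulVec (intVec q) - intVec p)‖ < r * d ∧
      ‖intVec q‖ < r * N := by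
  obtain ⟨_, ⟨⟨q, p⟩, rfl⟩, hlt⟩ := (Metric.infDist_lt_iff (Set.range_nonempty _)).1 h
  rw [Prod.dist_eq, max_lt_iff, dist_eq_norm, dist_eq_norm, ← smul_sub, zero_sub, norm_neg,
    norm_smul, norm_smul, Real.norm_of_nonneg (by positivity), Real.norm_of_nonneg (by positivity),
    inv_mul_lt_iff₀ hd, inv_mul_lt_iff₀ hN] at hlt
  exact ⟨q, p, by linarith [hlt.1], by linarith [hlt.2]⟩

theorem orbitGap_le {m n : ℕ} {A : Matrix (Fin m) (Fin n) ℝ} {d N r : ℝ} (hd : 0 < d)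
    (hN : 0 < N) {x : Fin m → ℝ} {q : Fin n → ℤ} {p : Fin m → ℤ}
    (h1 : ‖x - (A.mulVec (intVec q) - intVec p)‖ ≤ r * d) (h2 : ‖intVec q‖ ≤ r * N) :
    orbitGap A d N x ≤ r := by
  refine (Metric.infDist_le_dist_of_mem (Set.mem_range_self (q, p))).trans ?_
  rw [Prod.dist_eq, max_le_iff, dist_eq_norm, dist_eq_norm, ← smul_sub, zero_sub, norm_neg,
    norm_smul, norm_smul, Real.norm_of_nonneg (by positivity), Real.norm_of_nonneg (by positivity),
    inv_mul_le_iff₀ hd, inv_mul_le_iff₀ hN]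
  exact ⟨by linarith, by linarith⟩

theorem orbitGap_lt_add_one {m n : ℕ} {A : Matrix (Fin m) (Fin n) ℝ} {d N : ℝ} (hd : 0 < d)
    (hN : 0 < N) {x y : Fin m → ℝ} {q : Fin n → ℤ} {p : Fin m → ℤ}
    (h : ‖x - y - (A.mulVec (intVec q) - intVec p)‖ ≤ d / 2) (hq : ‖intVec q‖ ≤ N / 2) :
    orbitGap A d N x < orbitGap A d N y + 1 := by
  obtain ⟨q₀, p₀, h1, h2⟩ := exists_of_orbitGap_lt hd hN
    (lt_add_of_pos_right (orbitGap A d N y) (show (0 : ℝ) < 1 / 4 by norm_num))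
  refine (orbitGap_le (r := orbitGap A d N y + 3 / 4) hd hN (q := q₀ + q) (p := p₀ + p)
    ?_ ?_).trans_lt (by linarith)
  · rw [intVec_add, intVec_add, Matrix.mulVec_add]
    calc _ = ‖(y - (A.mulVec (intVec q₀) - intVec p₀)) +
          (x - y - (A.mulVec (intVec q) - intVec p))‖ := by congr 1; abel
      _ ≤ _ := norm_add_le _ _
      _ ≤ _ := by linarith
  · rw [intVec_add]
    refine (norm_add_le _ _).trans (by linarith)

/-- The number of integer values attained by `orbitGap` is bounded, since every value `k`
contributes a translate of a long piece of the orbit, and all of these are separated mod `1`. -/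
theorem card_orbitGap_values_le {m n : ℕ} (hm : 0 < m) {A : Matrix (Fin m) (Fin n) ℝ} {c : ℝ}
    (hc0 : 0 < c) (hc1 : c ≤ 1) (hc : ∀ q : Fin n → ℤ, q ≠ 0 → ∀ p : Fin m → ℤ,
      c ≤ ‖intVec q‖ ^ ((n : ℝ) / m) * ‖A.mulVec (intVec q) - intVec p‖)
    {N : ℝ} (hN : 1 ≤ N) (K : ℕ) (x : ℕ → Fin m → ℝ)
    (hx : ∀ k < K, orbitGap A (c * N ^ (-((n : ℝ) / m))) N (x k) = k) :
    (K : ℝ) ≤ 4 ^ n * (5 / c) ^ m := by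
  have hm' : (0 : ℝ) < m := by exact_mod_cast hm
  have hN0 : 0 < N := by linarith
  set d : ℝ := c * N ^ (-((n : ℝ) / m)) with hd
  have hdpos : 0 < d := mul_pos hc0 (Real.rpow_pos_of_pos hN0 _)
  have hd1 : d ≤ 1 := by
    refine mul_le_one₀ hc1 (Real.rpow_nonneg hN0.le _) ?_
    exact Real.rpow_le_one_of_one_le_of_nonpos hN (by rw [neg_nonpos]; positivity)
  have hdm : d ^ m = c ^ m / N ^ n := by
    rw [hd, mul_pow, ← Real.rpow_mul_natCast hN0.le, neg_mul, div_mul_cancel₀ _ hm'.ne',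
      Real.rpow_neg hN0.le, Real.rpow_natCast, div_eq_mul_inv]
  set Q : Finset (Fin n → ℤ) := Fintype.piFinset fun _ => Finset.Icc (-⌊N / 4⌋) ⌊N / 4⌋ with hQ
  have hQnorm : ∀ q ∈ Q, ‖intVec q‖ ≤ N / 4 := by
    intro q hq
    rw [pi_norm_le_iff_of_nonneg (by positivity)]
    intro j
    have hj := Finset.mem_Icc.1 (Fintype.mem_piFinset.1 hq j)
    have h1 : |q j| ≤ ⌊N / 4⌋ := abs_le.2 hj
    rw [Real.norm_eq_abs]
    calc |((q j : ℤ) : ℝ)| = ((|q j| : ℤ) : ℝ) := by push_cast; rfl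
      _ ≤ (⌊N / 4⌋ : ℝ) := by exact_mod_cast h1
      _ ≤ N / 4 := Int.floor_le _
  have hQcard : (N / 4) ^ n ≤ (Q.card : ℝ) := by
    rw [hQ, Fintype.card_piFinset]
    simp only [Int.card_Icc, Finset.prod_const, Finset.card_univ, Fintype.card_fin, Nat.cast_pow]
    gcongr
    have hfl : 0 ≤ ⌊N / 4⌋ := Int.floor_nonneg.2 (by positivity)
    have h1 : (((⌊N / 4⌋ + 1 - -⌊N / 4⌋).toNat : ℤ) : ℝ) = 2 * ⌊N / 4⌋ + 1 := by
      rw [Int.toNat_of_nonneg (by lia)]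
      push_cast
      ring
    rw [Int.cast_natCast] at h1
    rw [h1]
    have h2 := Int.lt_floor_add_one (N / 4)
    have h3 : (0 : ℝ) ≤ ⌊N / 4⌋ := by exact_mod_cast hfl
    linarith
  set w : ℕ × (Fin n → ℤ) → Fin m → ℝ := fun a => x a.1 + A.mulVec (intVec a.2) with hw
  set y : ℕ × (Fin n → ℤ) → Fin m → ℝ := fun a i => Int.fract (w a i) with hy
  have hyw : ∀ a, y a = w a - intVec fun i => ⌊w a i⌋ := fun a => rfl
  have key : ∀ a ∈ Finset.range K ×ˢ Q, ∀ b ∈ Finset.range K ×ˢ Q, a ≠ b → a.1 ≤ b.1 →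
      d / 2 ≤ dist (y a) (y b) := by
    rintro ⟨k, q⟩ ha ⟨k', q'⟩ hb hab hkk
    obtain ⟨hk, hq⟩ := Finset.mem_product.1 ha
    obtain ⟨hk', hq'⟩ := Finset.mem_product.1 hb
    simp only at hk hq hk' hq' hkk
    have hqn := hQnorm q hq
    have hqn' := hQnorm q' hq'
    have hqq : ‖intVec (q - q')‖ ≤ N / 2 := by
      rw [intVec_sub]
      exact (norm_sub_le _ _).trans (by linarith)
    obtain ⟨p, hp⟩ : ∃ p : Fin m → ℤ, y (k', q') - y (k, q) =
        x k' - x k - (A.mulVec (intVec (q - q')) - intVec p) := by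
      refine ⟨(fun i => ⌊w (k, q) i⌋) - fun i => ⌊w (k', q') i⌋, ?_⟩
      rw [hyw, hyw, intVec_sub, intVec_sub, Matrix.mulVec_sub]
      simp only [hw]
      abel
    rw [dist_comm, dist_eq_norm, hp]
    by_contra! hlt
    rcases hkk.lt_or_eq with h | h
    · have h1 := orbitGap_lt_add_one hdpos hN0 hlt.le hqq
      rw [hx k (Finset.mem_range.1 hk), hx k' (Finset.mem_range.1 hk')] at h1
      have h2 : (k : ℝ) + 1 ≤ k' := by exact_mod_cast h
      linarith
    · subst h
      have hne : q - q' ≠ 0 := by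
        rintro h0
        exact hab (by rw [sub_eq_zero.1 h0])
      have h1 := norm_mulVec_sub_ge hc hne p (hqq.trans (show N / 2 ≤ N by linarith))
      rw [sub_self, zero_sub, norm_neg] at hlt
      linarith
  have hsep : ∀ a ∈ Finset.range K ×ˢ Q, ∀ b ∈ Finset.range K ×ˢ Q, a ≠ b →
      d / 4 + d / 4 ≤ dist (y a) (y b) := by
    intro a ha b hb hab
    rcases le_total a.1 b.1 with h | h
    · linarith [key a ha b hb hab h]
    · rw [dist_comm]
      linarith [key b hb a ha hab.symm h]
  have hsum := sum_pow_le_of_pairwise _ y (fun _ => d / 4) (fun _ _ => by positivity) hsep 0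
    (1 + d / 4) (by positivity) (fun a _ => by
      have : dist (y a) 0 ≤ 1 := by
        rw [dist_zero_right, pi_norm_le_iff_of_nonneg zero_le_one]
        intro i
        rw [Real.norm_of_nonneg (Int.fract_nonneg _)]
        exact (Int.fract_lt_one _).le
      linarith)
  rw [Finset.sum_const, Finset.card_product, Finset.card_range, nsmul_eq_mul, Nat.cast_mul] at hsum
  have h5 : (1 + d / 4) ^ m ≤ (5 / 4) ^ m := by
    gcongr
    linarith
  have h6 : (K : ℝ) * (N / 4) ^ n * (d / 4) ^ m ≤ (5 / 4) ^ m := by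
    refine le_trans ?_ (hsum.trans h5)
    gcongr
  rw [div_pow, div_pow, hdm, div_pow] at h6
  rw [div_pow]
  have hNn : 0 < N ^ n := by positivity
  have hcm : 0 < c ^ m := by positivity
  have h7 : (K : ℝ) * (N ^ n / 4 ^ n) * (c ^ m / N ^ n / 4 ^ m) = K * c ^ m / 4 ^ n / 4 ^ m := by
    field_simp
  rw [h7, div_le_div_iff_of_pos_right (by positivity), div_le_iff₀ (by positivity)] at h6
  rw [← mul_div_assoc, le_div_iff₀ hcm]
  linarith

/-- Khintchine's transference for badly approximable matrices: the orbit points with `‖q‖ ≤ D * N`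
are `D * c * N ^ (-n / m)`-dense. -/
theorem exists_affineOrbit_dense {m n : ℕ} (hm : 0 < m) {A : Matrix (Fin m) (Fin n) ℝ} {c : ℝ}
    (hc0 : 0 < c) (hc1 : c ≤ 1) (hc : ∀ q : Fin n → ℤ, q ≠ 0 → ∀ p : Fin m → ℤ,
      c ≤ ‖intVec q‖ ^ ((n : ℝ) / m) * ‖A.mulVec (intVec q) - intVec p‖) :
    ∃ D : ℕ, 0 < D ∧ ∀ N : ℝ, 1 ≤ N → ∀ x, ∃ y ∈ affineOrbit A (D * N),
      dist x y ≤ D * (c * N ^ (-((n : ℝ) / m))) := by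
  obtain ⟨K, hK⟩ := exists_nat_gt ((4 : ℝ) ^ n * (5 / c) ^ m)
  refine ⟨K, ?_, fun N hN x => ?_⟩
  · have : (0 : ℝ) < K := lt_of_le_of_lt (by positivity) hK
    exact_mod_cast this
  have hN0 : 0 < N := by linarith
  set d : ℝ := c * N ^ (-((n : ℝ) / m)) with hd
  have hdpos : 0 < d := mul_pos hc0 (Real.rpow_pos_of_pos hN0 _)
  have hgap : orbitGap A d N x < K := by
    by_contra! hge
    have hex : ∀ k : ℕ, k < K → ∃ z, orbitGap A d N z = k := by
      intro k hk
      refine mem_range_of_exists_le_of_exists_ge (continuous_orbitGap A d N) ⟨0, ?_⟩ ⟨x, ?_⟩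
      · rw [orbitGap_zero]
        positivity
      · have : (k : ℝ) ≤ K := by exact_mod_cast hk.le
        linarith
    choose! z hz using hex
    exact absurd (card_orbitGap_values_le hm hc0 hc1 hc hN K z hz) (not_le.2 hK)
  obtain ⟨q, p, h1, h2⟩ := exists_of_orbitGap_lt hdpos hN0 hgap
  exact ⟨_, ⟨q, p, h2.le, rfl⟩, by rw [dist_eq_norm]; exact h1.le⟩

theorem exists_deloneTower_affineOrbit {m n : ℕ} (hm : 0 < m) (hn : 0 < n)
    {A : Matrix (Fin m) (Fin n) ℝ} (hA : BadlyApproximable m n A) :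
    ∃ (D R : ℕ) (d : ℕ → ℝ) (θ Λ C : ℝ), 0 < D ∧ 2 ≤ R ∧ 0 < C ∧
      DeloneTower (fun k => affineOrbit A (D * (R : ℝ) ^ k)) d θ Λ ∧ (∀ k, d k ≤ 1) ∧
      ∀ k, d k ^ m = C / ((R : ℝ) ^ k) ^ n := by
  have hm' : (0 : ℝ) < m := by exact_mod_cast hm
  have hn' : (0 : ℝ) < n := by exact_mod_cast hn
  obtain ⟨c, hc0, hc1, hc⟩ := hA.exists_const
  obtain ⟨D, hD, hcov⟩ := exists_affineOrbit_dense hm hc0 hc1 hc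
  set a : ℝ := (n : ℝ) / m with ha
  have ha0 : 0 < a := by positivity
  have hD1 : (1 : ℝ) ≤ D := by exact_mod_cast hD
  set Λ : ℝ := 2 * D * (2 * D) ^ a with hΛ
  have hpow : 1 ≤ (2 * D : ℝ) ^ a := Real.one_le_rpow (by linarith) ha0.le
  have hΛ1 : 1 ≤ Λ := by nlinarith
  obtain ⟨R, hRθ, hR2⟩ : ∃ R : ℕ, (R : ℝ) ^ (-a) ≤ 1 / (128 * Λ) ∧ 2 ≤ R :=
    ((((tendsto_rpow_neg_atTop ha0).comp tendsto_natCast_atTop_atTop).eventually_le_const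
      (show 0 < 1 / (128 * Λ) by positivity)).and (eventually_ge_atTop 2)).exists
  have hR0 : (0 : ℝ) < R := by
    have : 0 < R := by lia
    exact_mod_cast this
  have hR1 : (1 : ℝ) ≤ R := by
    have : 1 ≤ R := by lia
    exact_mod_cast this
  have hRk : ∀ k, (1 : ℝ) ≤ (R : ℝ) ^ k := fun k => one_le_pow₀ hR1
  have hM : ∀ k, (1 : ℝ) ≤ D * (R : ℝ) ^ k := fun k => one_le_mul_of_one_le_of_one_le hD1 (hRk k)
  refine ⟨D, R, fun k => c / 2 * (2 * (D * (R : ℝ) ^ k)) ^ (-a), (R : ℝ) ^ (-a), Λ,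
    (c / 2) ^ m / (2 * D) ^ n, hD, hR2, by positivity, ⟨hΛ1, Real.rpow_pos_of_pos hR0 _, hRθ,
      fun k => ?_, fun k => ?_, fun k l hkl => ?_, fun k y hy z hz hyz => ?_, fun k x => ?_⟩,
    fun k => ?_, fun k => ?_⟩
  · have := hM k
    positivity
  · rw [pow_succ', show 2 * ((D : ℝ) * (R * (R : ℝ) ^ k)) = R * (2 * (D * (R : ℝ) ^ k)) by ring,
      Real.mul_rpow hR0.le (by positivity)]
    ring
  · rintro _ ⟨q, p, hq, rfl⟩
    refine ⟨q, p, hq.trans ?_, rfl⟩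
    gcongr
  · have := affineOrbit_separated hc0 hc1 hc (hM k) hy hz hyz
    linarith
  · obtain ⟨y, hy, hxy⟩ := hcov _ (hRk k) x
    refine ⟨y, hy, hxy.trans (le_of_eq ?_)⟩
    rw [← mul_assoc 2, Real.mul_rpow (x := 2 * (D : ℝ)) (by positivity) (by positivity),
      Real.rpow_neg (x := 2 * (D : ℝ)) (by positivity), hΛ]
    field_simp
  · have h1 : (2 * (D * (R : ℝ) ^ k)) ^ (-a) ≤ 1 :=
      Real.rpow_le_one_of_one_le_of_nonpos (by linarith [hM k]) (by linarith)
    nlinarith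
  · have h2 : (0 : ℝ) ≤ 2 * (D * (R : ℝ) ^ k) := by positivity
    rw [mul_pow, ← Real.rpow_mul_natCast h2, neg_mul, ha, div_mul_cancel₀ _ hm'.ne',
      Real.rpow_neg h2, Real.rpow_natCast, ← mul_assoc, mul_pow (2 * (D : ℝ))]
    field_simp

/-- A form of Cauchy condensation along the sequence `D * R ^ k`. -/
theorem not_summable_condensed {n : ℕ} (hn : 0 < n) {ψ : ℝ → ℝ} (hψpos : ∀ r : ℝ, 0 < r → 0 < ψ r)
    (hψdec : ∀ x y : ℝ, 0 < x → x ≤ y → ψ y ≤ ψ x) {s : ℝ} (hs0 : 0 ≤ s)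
    (hdiv : ¬ Summable fun q : ℕ => ((q : ℝ) + 1) ^ (n - 1) * ψ ((q : ℝ) + 1) ^ s)
    {D R : ℕ} (hD : 0 < D) (hR : 2 ≤ R) :
    ¬ Summable fun k : ℕ => ((R : ℝ) ^ k) ^ n * ψ (D * (R : ℝ) ^ k) ^ s := by
  intro hsum
  apply hdiv
  have hR0 : (0 : ℝ) < R := by
    have : 0 < R := by lia
    exact_mod_cast this
  have hD0 : (0 : ℝ) < D := by exact_mod_cast hD
  set a : ℕ → ℝ := fun q => ((q : ℝ) + 1) ^ (n - 1) * ψ ((q : ℝ) + 1) ^ s with ha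
  set b : ℕ → ℝ := fun k => ((R : ℝ) ^ k) ^ n * ψ (D * (R : ℝ) ^ k) ^ s with hb
  have ha0 : ∀ q, 0 ≤ a q := fun q => by
    have := hψpos ((q : ℝ) + 1) (by positivity)
    positivity
  have hb0 : ∀ k, 0 ≤ b k := fun k => by
    have := hψpos (D * (R : ℝ) ^ k) (by positivity)
    positivity
  have hblock : ∀ k, ∑ q ∈ Finset.Ico (D * R ^ k) (D * R ^ (k + 1)), a q ≤
      ((D : ℝ) * R) ^ n * b k := by
    intro k
    have hterm : ∀ q ∈ Finset.Ico (D * R ^ k) (D * R ^ (k + 1)), a q ≤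
        ((D * R ^ (k + 1) : ℕ) : ℝ) ^ (n - 1) * ψ (D * (R : ℝ) ^ k) ^ s := by
      intro q hq
      obtain ⟨h1, h2⟩ := Finset.mem_Ico.1 hq
      have h1' : (D : ℝ) * (R : ℝ) ^ k ≤ q := by exact_mod_cast h1
      have h2' : (q : ℝ) + 1 ≤ ((D * R ^ (k + 1) : ℕ) : ℝ) := by exact_mod_cast h2
      have h3 := hψdec (D * (R : ℝ) ^ k) ((q : ℝ) + 1) (by positivity) (by linarith)
      have h4 := hψpos ((q : ℝ) + 1) (by positivity)
      simp only [ha]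
      gcongr
    refine (Finset.sum_le_card_nsmul _ _ _ hterm).trans ?_
    rw [Nat.card_Ico, nsmul_eq_mul]
    have h5 := hψpos (D * (R : ℝ) ^ k) (by positivity)
    calc ((D * R ^ (k + 1) - D * R ^ k : ℕ) : ℝ) *
          (((D * R ^ (k + 1) : ℕ) : ℝ) ^ (n - 1) * ψ (D * (R : ℝ) ^ k) ^ s)
        ≤ ((D * R ^ (k + 1) : ℕ) : ℝ) *
          (((D * R ^ (k + 1) : ℕ) : ℝ) ^ (n - 1) * ψ (D * (R : ℝ) ^ k) ^ s) := by
          gcongr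
          exact Nat.sub_le _ _
      _ = ((D * R ^ (k + 1) : ℕ) : ℝ) ^ n * ψ (D * (R : ℝ) ^ k) ^ s := by
          rw [← mul_assoc, mul_pow_sub_one hn.ne']
      _ = ((D : ℝ) * R) ^ n * b k := by
          simp only [hb]
          push_cast
          rw [pow_succ]
          ring
  have htotal : ∀ K, ∑ q ∈ Finset.range (D * R ^ K), a q ≤
      ∑ q ∈ Finset.range D, a q + ((D : ℝ) * R) ^ n * ∑ k ∈ Finset.range K, b k := by
    intro K
    induction K with
    | zero => simp
    | succ K ih =>
      have hle : D * R ^ K ≤ D * R ^ (K + 1) :=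
        Nat.mul_le_mul_left _ (Nat.pow_le_pow_right (by lia) (by lia))
      rw [← Finset.sum_range_add_sum_Ico _ hle, Finset.sum_range_succ, mul_add]
      linarith [hblock K]
  refine summable_of_sum_range_le (c := ∑ q ∈ Finset.range D, a q + ((D : ℝ) * R) ^ n * ∑' k, b k)
    ha0 fun K => ?_
  have hK : K ≤ D * R ^ K :=
    (Nat.lt_pow_self (by lia : 1 < R)).le.trans (Nat.le_mul_of_pos_left _ hD)
  calc ∑ q ∈ Finset.range K, a q ≤ ∑ q ∈ Finset.range (D * R ^ K), a q :=
        Finset.sum_le_sum_of_subset_of_nonneg (Finset.range_mono hK) fun q _ _ => ha0 q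
    _ ≤ _ := htotal K
    _ ≤ _ := by
        gcongr
        exact hsum.sum_le_tsum _ fun k _ => hb0 k

theorem limitSet_inter_Icc_subset_WA {m n : ℕ} {A : Matrix (Fin m) (Fin n) ℝ} {ψ : ℝ → ℝ}
    (hψpos : ∀ r : ℝ, 0 < r → 0 < ψ r) (hψdec : ∀ x y : ℝ, 0 < x → x ≤ y → ψ y ≤ ψ x)
    {D R : ℕ} (hD : 0 < D) (hR : 2 ≤ R) :
    DeloneTower.limitSet (fun k => affineOrbit A (D * (R : ℝ) ^ k))
      (fun k => ψ (D * (R : ℝ) ^ k) / 2) ∩ Set.Icc 0 1 ⊆ WA m n A ψ := by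
  rintro z ⟨hz, hzI⟩
  refine ⟨hzI, fun hfin => ?_⟩
  have hR1 : (1 : ℝ) < R := by exact_mod_cast hR
  have hD1 : (1 : ℝ) ≤ D := by exact_mod_cast hD
  obtain ⟨B, hB⟩ := (hfin.image fun q => ‖intVec q‖).bddAbove
  obtain ⟨K, hK⟩ := pow_unbounded_of_one_lt B hR1
  obtain ⟨l, hKl, _, ⟨q, p, hq, rfl⟩, hnot, hdist⟩ := hz K
  have hlarge : D * (R : ℝ) ^ l < ‖intVec q‖ := by
    by_contra! h
    exact hnot ⟨q, p, h, rfl⟩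
  have hBl : B < D * (R : ℝ) ^ l := by
    have h1 : (R : ℝ) ^ K ≤ (R : ℝ) ^ l := pow_le_pow_right₀ hR1.le hKl
    have h2 : (0 : ℝ) ≤ (R : ℝ) ^ l := by positivity
    nlinarith
  have hq0 : 0 < ‖intVec q‖ := lt_of_le_of_lt (by positivity) hlarge
  have hmem : intDist (A.mulVec (intVec q) - z) < ψ ‖intVec q‖ := by
    calc intDist (A.mulVec (intVec q) - z) ≤ ‖A.mulVec (intVec q) - z - intVec p‖ :=
          intDist_le _ _
      _ = dist z (A.mulVec (intVec q) - intVec p) := by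
          rw [dist_comm, dist_eq_norm]
          congr 1
          abel
      _ ≤ ψ (D * (R : ℝ) ^ (l + 1)) / 2 := hdist
      _ < ψ (D * (R : ℝ) ^ (l + 1)) := half_lt_self (hψpos _ (by positivity))
      _ ≤ ψ ‖intVec q‖ := hψdec _ _ hq0 hq
  have := hB ⟨q, hmem, rfl⟩
  simp only at this
  linarith

theorem closedBall_half_subset_Icc {m : ℕ} :
    Metric.closedBall (fun _ => 1 / 2 : Fin m → ℝ) (1 / 2) ⊆ Set.Icc 0 1 := by
  intro z hz
  rw [Metric.mem_closedBall, dist_pi_le_iff (by norm_num)] at hz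
  refine ⟨fun i => ?_, fun i => ?_⟩ <;>
  · have := abs_le.1 (Real.dist_eq (z i) _ ▸ hz i)
    simp only [Pi.zero_apply, Pi.one_apply]
    linarith [this.1, this.2]

theorem hausdorffMeasure_WA_of_not_summable {m n : ℕ} (hm : 0 < m) (hn : 0 < n)
    {A : Matrix (Fin m) (Fin n) ℝ} (hA : BadlyApproximable m n A)
    {ψ : ℝ → ℝ} (hψpos : ∀ r : ℝ, 0 < r → 0 < ψ r)
    (hψdec : ∀ x y : ℝ, 0 < x → x ≤ y → ψ y ≤ ψ x) {s : ℝ} (hs0 : 0 ≤ s) (hsm : s ≤ m)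
    (hdiv : ¬ Summable fun q : ℕ => ((q : ℝ) + 1) ^ (n - 1) * ψ ((q : ℝ) + 1) ^ s) :
    μH[s] (WA m n A ψ) = μH[s] (Set.Icc (0 : Fin m → ℝ) 1) := by
  obtain ⟨D, R, d, θ, Λ, C, hD, hR, hC, H, hd, hdm⟩ := exists_deloneTower_affineOrbit hm hn hA
  have hR0 : (0 : ℝ) < R := by
    have : 0 < R := by lia
    exact_mod_cast this
  have hD0 : (0 : ℝ) < D := by exact_mod_cast hD
  have hψk : ∀ k, 0 < ψ (D * (R : ℝ) ^ k) := fun k => hψpos _ (by positivity)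
  set φ : ℕ → ℝ := fun k => ψ (D * (R : ℝ) ^ k) / 2 with hφdef
  have hφ : ∀ k, 0 < φ k := fun k => half_pos (hψk k)
  have hdivφ : ¬ Summable fun k => φ k ^ s / d k ^ m := by
    have h1 := not_summable_condensed hn hψpos hψdec hs0 hdiv hD hR
    have h2 : (fun k => φ k ^ s / d k ^ m) = fun k =>
        (1 / ((2 : ℝ) ^ s * C)) * (((R : ℝ) ^ k) ^ n * ψ (D * (R : ℝ) ^ k) ^ s) := by
      funext k
      rw [hdm, hφdef, Real.div_rpow (hψk k).le (by norm_num)]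
      have : (0 : ℝ) < 2 ^ s := by positivity
      field_simp
    rwa [h2, summable_mul_left_iff (by positivity)]
  have hsub := limitSet_inter_Icc_subset_WA (A := A) hψpos hψdec hD hR
  rcases hsm.lt_or_eq with hlt | rfl
  · have htop := H.hausdorffMeasure_limitSet_inter hm hd hφ hs0 hlt hdivφ (fun _ => 1 / 2)
      (show (0 : ℝ) < 1 / 2 by norm_num)
    have h1 : μH[s] (WA m n A ψ) = ⊤ := by
      rw [eq_top_iff, ← htop]
      exact measure_mono
        ((Set.inter_subset_inter_right _ closedBall_half_subset_Icc).trans hsub)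
    rw [h1, eq_comm, eq_top_iff, ← h1]
    exact measure_mono fun z hz => hz.1
  · have hvol : (μH[(m : ℝ)] : Measure (Fin m → ℝ)) = volume := by
      have := hausdorffMeasure_pi_real (ι := Fin m)
      rwa [Fintype.card_fin] at this
    have hnull := H.volume_compl_limitSet hm hφ (by
      have h1 := DeloneTower.not_summable_min hdivφ one_pos
      convert h1 using 3 with k
      have := H.pos k
      have := hφ k
      rw [Real.rpow_natCast, ← div_pow]
      rcases le_total (φ k) (d k) with h | h
      · rw [min_eq_left h, min_eq_left]
        exact pow_le_one₀ (by positivity) (by rwa [div_le_one (by positivity)])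
      · rw [min_eq_right h, min_eq_right, div_self (by positivity), one_pow]
        exact one_le_pow₀ (by rwa [one_le_div (by positivity)]))
    rw [hvol]
    refine le_antisymm (measure_mono fun z hz => hz.1) ?_
    calc volume (Set.Icc (0 : Fin m → ℝ) 1)
        ≤ volume (WA m n A ψ ∪ (DeloneTower.limitSet _ φ)ᶜ) := by
          refine measure_mono fun z hz => ?_
          by_cases h : z ∈ DeloneTower.limitSet (fun k => affineOrbit A (D * (R : ℝ) ^ k)) φ
          · exact Or.inl (hsub ⟨h, hz⟩)
          · exact Or.inr h
      _ ≤ volume (WA m n A ψ) + 0 := by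
          rw [← hnull]
          exact measure_union_le _ _
      _ = _ := add_zero _

/-- Hausdorff–Cantelli lemma. -/
theorem hausdorffMeasure_eq_zero_of_infinite_mem {X ι : Type*} [MetricSpace X] [MeasurableSpace X]
    [BorelSpace X] [Countable ι] (t : ι → Set X) {s : ℝ} (hs : 0 < s)
    (hsum : ∑' i, Metric.ediam (t i) ^ s ≠ ⊤) {E : Set X}
    (hE : ∀ x ∈ E, {i | x ∈ t i}.Infinite) : μH[s] E = 0 := by
  have htail := ENNReal.tendsto_tsum_compl_atTop_zero hsum
  have hroot : Tendsto (fun F : Finset ι =>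
      (∑' b : {i // i ∉ F}, Metric.ediam (t b) ^ s) ^ (1 / s)) atTop (nhds 0) := by
    have := (ENNReal.continuous_rpow_const (y := 1 / s)).tendsto 0 |>.comp htail
    rwa [ENNReal.zero_rpow_of_pos (by positivity)] at this
  have hle := Measure.hausdorffMeasure_le_liminf_tsum s E (ι := fun F : Finset ι => {i // i ∉ F})
    _ hroot (fun F i => t i) (Eventually.of_forall fun F i => ?_) (Eventually.of_forall fun F => ?_)
  · rw [htail.liminf_eq] at hle
    exact le_antisymm hle zero_le
  · rw [one_div, ENNReal.le_rpow_inv_iff hs]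
    exact ENNReal.le_tsum (f := fun b : {i // i ∉ F} => Metric.ediam (t b) ^ s) i
  · intro x hx
    obtain ⟨i, hi, hiF⟩ := (hE x hx).exists_notMem_finset F
    exact Set.mem_iUnion.2 ⟨⟨i, hiF⟩, hi⟩

/-- Supremum norm of an integer vector, as a natural number. -/
def supNat {n : ℕ} (q : Fin n → ℤ) : ℕ := Finset.univ.sup fun j => (q j).natAbs

theorem norm_intVec {n : ℕ} (q : Fin n → ℤ) : ‖intVec q‖ = supNat q := by
  refine le_antisymm ?_ ?_
  · rw [pi_norm_le_iff_of_nonneg (by positivity)]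
    intro j
    have h : (q j).natAbs ≤ supNat q :=
      Finset.le_sup (f := fun j => (q j).natAbs) (Finset.mem_univ j)
    rw [Real.norm_eq_abs, ← Int.cast_abs, Int.abs_eq_natAbs, Int.cast_natCast]
    exact_mod_cast h
  · rcases isEmpty_or_nonempty (Fin n) with h | h
    · simp [supNat]
    · obtain ⟨j, -, hj⟩ := Finset.exists_mem_eq_sup Finset.univ Finset.univ_nonempty
        fun j => (q j).natAbs
      rw [supNat, hj]
      refine le_trans (le_of_eq ?_) (norm_le_pi_norm (intVec q) j)
      rw [Real.norm_eq_abs, ← Int.cast_abs, Int.abs_eq_natAbs, Int.cast_natCast]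

theorem exists_finset_supNat_eq (n N : ℕ) : ∃ T : Finset (Fin n → ℤ),
    (∀ q : Fin n → ℤ, q ≠ 0 → supNat q = N → q ∈ T) ∧
      T.card ≤ n * (2 * (2 * N + 1) ^ (n - 1)) := by
  classical
  refine ⟨Finset.univ.biUnion fun j => Fintype.piFinset fun i =>
    if i = j then {(N : ℤ), -(N : ℤ)} else Finset.Icc (-(N : ℤ)) N, fun q hq hqN => ?_, ?_⟩
  · have : Nonempty (Fin n) := ⟨(Function.ne_iff.1 hq).choose⟩
    obtain ⟨j, -, hj⟩ := Finset.exists_mem_eq_sup Finset.univ Finset.univ_nonempty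
      fun j => (q j).natAbs
    have hj' : (q j).natAbs = N := by rw [← hqN, supNat, hj]
    refine Finset.mem_biUnion.2 ⟨j, Finset.mem_univ _, Fintype.mem_piFinset.2 fun i => ?_⟩
    split_ifs with h
    · subst h
      rw [Finset.mem_insert, Finset.mem_singleton]
      lia
    · have h1 : (q i).natAbs ≤ supNat q :=
        Finset.le_sup (f := fun j => (q j).natAbs) (Finset.mem_univ i)
      rw [Finset.mem_Icc]
      lia
  · refine (Finset.card_biUnion_le_card_mul _ _ (2 * (2 * N + 1) ^ (n - 1)) fun j _ => ?_).trans
      (by simp)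
    rw [Fintype.card_piFinset, ← Finset.mul_prod_erase _ _ (Finset.mem_univ j)]
    refine Nat.mul_le_mul ?_ (le_of_eq ?_)
    · rw [if_pos rfl]
      exact Finset.card_le_two
    · rw [Finset.prod_congr rfl (g := fun _ => 2 * N + 1) fun i hi => ?_, Finset.prod_const,
        Finset.card_erase_of_mem (Finset.mem_univ j), Finset.card_univ, Fintype.card_fin]
      rw [if_neg (Finset.ne_of_mem_erase hi), Int.card_Icc]
      lia

theorem tsum_intVec_ne_top {n : ℕ} {ψ : ℝ → ℝ} (hψpos : ∀ r : ℝ, 0 < r → 0 < ψ r) {s : ℝ}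
    (hsum : Summable fun q : ℕ => ((q : ℝ) + 1) ^ (n - 1) * ψ ((q : ℝ) + 1) ^ s) :
    ∑' q : {q : Fin n → ℤ // q ≠ 0}, ENNReal.ofReal (ψ ‖intVec q.1‖ ^ s) ≠ ⊤ := by
  rw [← ENNReal.tsum_fiberwise _ fun q : {q : Fin n → ℤ // q ≠ 0} => supNat q.1 - 1]
  refine ne_top_of_le_ne_top (hsum.mul_left ((n : ℝ) * (2 * 3 ^ (n - 1)))).tsum_ofReal_ne_top
    (ENNReal.tsum_le_tsum fun k => ?_)
  have hψk := hψpos ((k : ℝ) + 1) (by positivity)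
  obtain ⟨T, hT, hcard⟩ := exists_finset_supNat_eq n (k + 1)
  have hfib : ∀ q : (fun q : {q : Fin n → ℤ // q ≠ 0} => supNat q.1 - 1) ⁻¹' {k},
      supNat q.1.1 = k + 1 := by
    rintro ⟨⟨q, hq⟩, hqk⟩
    have h1 : supNat q - 1 = k := hqk
    have h2 := one_le_norm_intVec hq
    rw [norm_intVec] at h2
    have h3 : 1 ≤ supNat q := by exact_mod_cast h2
    lia
  calc _ = ∑' q : (fun q : {q : Fin n → ℤ // q ≠ 0} => supNat q.1 - 1) ⁻¹' {k},
          ENNReal.ofReal (ψ ((k : ℝ) + 1) ^ s) := by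
        refine tsum_congr fun q => ?_
        rw [norm_intVec, hfib q]
        push_cast
        rfl
    _ ≤ ∑' q : {q // q ∈ T}, ENNReal.ofReal (ψ ((k : ℝ) + 1) ^ s) :=
        ENNReal.tsum_comp_le_tsum_of_injective
          (f := fun q : (fun q : {q : Fin n → ℤ // q ≠ 0} => supNat q.1 - 1) ⁻¹' {k} =>
            (⟨q.1.1, hT _ q.1.2 (hfib q)⟩ : {q // q ∈ T}))
          (fun q q' h => Subtype.ext (Subtype.ext (Subtype.mk.inj h)))
          (fun _ => ENNReal.ofReal (ψ ((k : ℝ) + 1) ^ s))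
    _ = ENNReal.ofReal (T.card * ψ ((k : ℝ) + 1) ^ s) := by
        rw [tsum_fintype, Finset.sum_const, Finset.card_univ, Fintype.card_coe, nsmul_eq_mul,
          ENNReal.ofReal_mul (by positivity), ENNReal.ofReal_natCast]
    _ ≤ _ := by
        refine ENNReal.ofReal_le_ofReal ?_
        have h1 : (T.card : ℝ) ≤ n * (2 * (2 * ((k : ℝ) + 1) + 1) ^ (n - 1)) := by
          exact_mod_cast hcard
        have h2 : (2 * ((k : ℝ) + 1) + 1) ^ (n - 1) ≤ 3 ^ (n - 1) * ((k : ℝ) + 1) ^ (n - 1) := by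
          rw [← mul_pow]
          gcongr
          have : (0 : ℝ) ≤ k := by positivity
          linarith
        calc (T.card : ℝ) * ψ ((k : ℝ) + 1) ^ s
            ≤ n * (2 * (3 ^ (n - 1) * ((k : ℝ) + 1) ^ (n - 1))) * ψ ((k : ℝ) + 1) ^ s := by
              gcongr
              refine h1.trans ?_
              gcongr
          _ = _ := by ring

theorem hausdorffMeasure_WA_of_summable {m n : ℕ} {A : Matrix (Fin m) (Fin n) ℝ} {ψ : ℝ → ℝ}
    (hψpos : ∀ r : ℝ, 0 < r → 0 < ψ r) {s : ℝ} (hs0 : 0 ≤ s)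
    (hsum : Summable fun q : ℕ => ((q : ℝ) + 1) ^ (n - 1) * ψ ((q : ℝ) + 1) ^ s) :
    μH[s] (WA m n A ψ) = 0 := by
  have hs : 0 < s := by
    refine lt_of_le_of_ne hs0 fun h => ?_
    subst h
    obtain ⟨k, hk⟩ := (hsum.tendsto_atTop_zero.eventually_lt_const one_pos).exists
    rw [Real.rpow_zero, mul_one] at hk
    have : (1 : ℝ) ≤ ((k : ℝ) + 1) ^ (n - 1) :=
      one_le_pow₀ (by have : (0 : ℝ) ≤ k := by positivity
                      linarith)
    linarith
  have htop := tsum_intVec_ne_top hψpos hsum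
  have hbig : {q : {q : Fin n → ℤ // q ≠ 0} | 1 < ψ ‖intVec q.1‖}.Finite := by
    refine (ENNReal.finite_const_le_of_tsum_ne_top htop one_ne_zero).subset fun q hq => ?_
    have hq' : 1 < ψ ‖intVec q.1‖ := hq
    rw [Set.mem_ofPred_eq, ← ENNReal.ofReal_one]
    exact ENNReal.ofReal_le_ofReal (Real.one_le_rpow hq'.le hs.le)
  set t : {q : Fin n → ℤ // q ≠ 0} × (Fin m → Fin 3) → Set (Fin m → ℝ) := fun i =>
    Metric.closedBall (A.mulVec (intVec i.1.1) -
      intVec fun j => ⌊A.mulVec (intVec i.1.1) j⌋ + ((i.2 j : ℕ) : ℤ) - 1)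
      (ψ ‖intVec i.1.1‖) with ht
  have hpos : ∀ q : {q : Fin n → ℤ // q ≠ 0}, 0 < ψ ‖intVec q.1‖ := fun q =>
    hψpos _ (zero_lt_one.trans_le (one_le_norm_intVec q.2))
  have hdiam : ∀ i, Metric.ediam (t i) ^ s ≤
      ENNReal.ofReal (2 ^ s) * ENNReal.ofReal (ψ ‖intVec i.1.1‖ ^ s) := by
    intro i
    have := hpos i.1
    rw [← ENNReal.ofReal_mul (by positivity), ← Real.mul_rpow (by norm_num) this.le,
      ← ENNReal.ofReal_rpow_of_nonneg (by positivity) hs.le]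
    gcongr
    refine Metric.ediam_le_of_forall_dist_le fun u hu v hv => ?_
    have hu' := Metric.mem_closedBall.1 hu
    have hv' := Metric.mem_closedBall.1 hv
    exact (dist_triangle_right u v _).trans (by linarith)
  refine hausdorffMeasure_eq_zero_of_infinite_mem t hs ?_ ?_
  · refine ne_top_of_le_ne_top ?_ (ENNReal.tsum_le_tsum hdiam)
    rw [ENNReal.tsum_mul_left, ENNReal.tsum_prod (f := fun (q : {q : Fin n → ℤ // q ≠ 0})
      (_ : Fin m → Fin 3) => ENNReal.ofReal (ψ ‖intVec q.1‖ ^ s))]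
    simp only [tsum_fintype, Finset.sum_const, nsmul_eq_mul]
    rw [ENNReal.tsum_mul_left]
    exact ENNReal.mul_ne_top ENNReal.ofReal_ne_top
      (ENNReal.mul_ne_top (ENNReal.natCast_ne_top _) htop)
  · rintro b ⟨hb, hinf⟩ hfin
    refine hinf ((((hfin.image fun i => i.1.1).union (hbig.image Subtype.val)).union
      (Set.finite_singleton 0)).subset fun q hq => ?_)
    by_cases hq0 : q = 0
    · exact Or.inr hq0
    refine Or.inl ?_
    by_cases hq1 : 1 < ψ ‖intVec q‖
    · exact Or.inr ⟨⟨q, hq0⟩, hq1, rfl⟩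
    refine Or.inl ?_
    push Not at hq1
    obtain ⟨p, hp⟩ := exists_norm_sub_lt_of_intDist_lt (x := A.mulVec (intVec q) - b)
      (ε := ψ ‖intVec q‖) hq
    have hcoord : ∀ j, ⌊A.mulVec (intVec q) j⌋ - 1 ≤ p j ∧ p j ≤ ⌊A.mulVec (intVec q) j⌋ + 1 := by
      intro j
      have h1 := (norm_le_pi_norm (A.mulVec (intVec q) - b - intVec p) j).trans_lt hp
      rw [Real.norm_eq_abs, abs_lt] at h1
      have h1' : -ψ ‖intVec q‖ < A.mulVec (intVec q) j - b j - p j ∧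
          A.mulVec (intVec q) j - b j - p j < ψ ‖intVec q‖ := h1
      have h2 : 0 ≤ b j := hb.1 j
      have h3 : b j ≤ 1 := hb.2 j
      have h4 := Int.floor_le (A.mulVec (intVec q) j)
      have h5 := Int.lt_floor_add_one (A.mulVec (intVec q) j)
      have h6 : ⌊A.mulVec (intVec q) j⌋ - 2 < p j := by
        have : (⌊A.mulVec (intVec q) j⌋ : ℝ) - 2 < p j := by linarith [h1'.2]
        exact_mod_cast this
      have h7 : p j < ⌊A.mulVec (intVec q) j⌋ + 2 := by
        have : (p j : ℝ) < ⌊A.mulVec (intVec q) j⌋ + 2 := by linarith [h1'.1]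
        exact_mod_cast this
      lia
    refine ⟨(⟨q, hq0⟩, fun j => ⟨(p j - ⌊A.mulVec (intVec q) j⌋ + 1).toNat, by
      have := hcoord j
      lia⟩), ?_, rfl⟩
    have hp' : (fun j => ⌊A.mulVec (intVec q) j⌋ +
        (((p j - ⌊A.mulVec (intVec q) j⌋ + 1).toNat : ℕ) : ℤ) - 1) = p := by
      funext j
      have := hcoord j
      lia
    rw [Set.mem_ofPred_eq, ht]
    simp only
    rw [hp', Metric.mem_closedBall, dist_comm, dist_eq_norm, sub_right_comm]
    exact hp.le

/-- Hausdorff measure version of Kurzweil's theorem: if `A` is badly approximable,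
then for any decreasing `ψ` and `0 ≤ s ≤ m`, `ℋ^s(W_A(ψ))` is `0` or
`ℋ^s([0,1]^m)` according to convergence or divergence of `∑ q^{n-1} ψ(q)^s`. -/
theorem kurzweil_hausdorff (m n : ℕ) (hm : 0 < m) (hn : 0 < n)
    (A : Matrix (Fin m) (Fin n) ℝ) (hA : BadlyApproximable m n A)
    (ψ : ℝ → ℝ) (hψpos : ∀ r : ℝ, 0 < r → 0 < ψ r)
    (hψdec : ∀ x y : ℝ, 0 < x → x ≤ y → ψ y ≤ ψ x)
    (s : ℝ) (hs0 : 0 ≤ s) (hsm : s ≤ m) :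
    (Summable (fun q : ℕ => ((q : ℝ) + 1) ^ (n - 1) * ψ ((q : ℝ) + 1) ^ s) →
      μH[s] (WA m n A ψ) = 0) ∧
    (¬ Summable (fun q : ℕ => ((q : ℝ) + 1) ^ (n - 1) * ψ ((q : ℝ) + 1) ^ s) →
      μH[s] (WA m n A ψ) = μH[s] (Set.Icc (0 : Fin m → ℝ) 1)) := by
  exact ⟨hausdorffMeasure_WA_of_summable hψpos hs0,
    hausdorffMeasure_WA_of_not_summable hm hn hA hψpos hψdec hs0 hsm⟩
end

section
/- Let m, n be positive integers. For every A ∈ M_{m,n}(ℝ), every decreasing function ψ : ℝ⁺ → ℝ⁺ and every 0 ≤ s ≤ m: if ∑_{q=1}^∞ q^{n-1} ψ(q)^s < ∞, then ℋ^s(W_A(ψ)) = 0. -/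
open MeasureTheory Filter

/-- Convergence half of the Borel–Cantelli lemma for Hausdorff measures: the limsup set of a
countable family with `∑ diam ^ s < ∞` is `s`-null. -/
theorem hausdorffMeasure_limsup_cofinite_eq_zero {X ι : Type*} [EMetricSpace X]
    [MeasurableSpace X] [BorelSpace X] [Countable ι] {s : ℝ} (hs : 0 < s) (E : ι → Set X)
    (hE : ∑' i, Metric.ediam (E i) ^ s ≠ ⊤) :
    μH[s] {x | {i | x ∈ E i}.Infinite} = 0 := by
  have htail := ENNReal.tendsto_tsum_compl_atTop_zero hE
  have hr : Tendsto (fun F : Finset ι =>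
      (∑' i : {i // i ∉ F}, Metric.ediam (E i) ^ s) ^ (1 / s)) atTop (nhds 0) := by
    have h := (ENNReal.continuous_rpow_const (y := 1 / s)).tendsto 0 |>.comp htail
    rwa [ENNReal.zero_rpow_of_pos (by positivity)] at h
  have hle := Measure.hausdorffMeasure_le_liminf_tsum s {x | {i | x ∈ E i}.Infinite} _ hr
    (fun F (i : {i // i ∉ F}) => E i) (Eventually.of_forall fun F i => by
      rw [one_div, ENNReal.le_rpow_inv_iff hs]
      exact ENNReal.le_tsum (f := fun i : {i // i ∉ F} => Metric.ediam (E i) ^ s) i)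
    (Eventually.of_forall fun F x hx => by
      obtain ⟨i, hi, hiF⟩ := Set.Infinite.exists_notMem_finset hx F
      exact Set.mem_iUnion.2 ⟨⟨i, hiF⟩, hi⟩)
  rw [htail.liminf_eq] at hle
  exact nonpos_iff_eq_zero.1 hle

/-- The sup norm of an integer vector, as a natural number. -/
noncomputable def supNatAbs {n : ℕ} (q : Fin n → ℤ) : ℕ :=
  Finset.univ.sup fun j => (q j).natAbs

theorem supNatAbs_le_iff {n : ℕ} {q : Fin n → ℤ} {k : ℕ} :
    supNatAbs q ≤ k ↔ ∀ j, (q j).natAbs ≤ k := by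
  simp [supNatAbs]

theorem norm_intCast_eq_supNatAbs {n : ℕ} (q : Fin n → ℤ) :
    ‖(fun j => (q j : ℝ))‖ = supNatAbs q := by
  have habs : ∀ j, ‖(q j : ℝ)‖ = ((q j).natAbs : ℝ) := fun j => by
    rw [Real.norm_eq_abs, Nat.cast_natAbs, Int.cast_abs]
  apply le_antisymm
  · refine (pi_norm_le_iff_of_nonneg (Nat.cast_nonneg _)).2 fun j => ?_
    rw [habs]
    exact_mod_cast supNatAbs_le_iff.1 le_rfl j
  · rw [← Nat.le_floor_iff (norm_nonneg _), supNatAbs_le_iff]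
    intro j
    rw [Nat.le_floor_iff (norm_nonneg _), ← habs]
    exact norm_le_pi_norm (fun j => (q j : ℝ)) j

/-- The finset of integer vectors of sup norm at most `k`. -/
noncomputable def supBall (n k : ℕ) : Finset (Fin n → ℤ) :=
  Fintype.piFinset fun _ => Finset.Icc (-k : ℤ) k

theorem mem_supBall {n k : ℕ} {q : Fin n → ℤ} : q ∈ supBall n k ↔ supNatAbs q ≤ k := by
  simp only [supBall, Fintype.mem_piFinset, Finset.mem_Icc, supNatAbs_le_iff]
  exact forall_congr' fun j => by omega

theorem card_supBall (n k : ℕ) : (supBall n k).card = (2 * k + 1) ^ n := by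
  simp only [supBall, Fintype.card_piFinset, Int.card_Icc, Finset.prod_const, Finset.card_univ,
    Fintype.card_fin]
  congr 1
  omega

theorem card_supBall_sdiff_le (n k : ℕ) :
    (supBall n (k + 1) \ supBall n k).card ≤ 2 * n * 3 ^ (n - 1) * (k + 1) ^ (n - 1) := by
  have hsub : supBall n k ⊆ supBall n (k + 1) := fun q hq =>
    mem_supBall.2 ((mem_supBall.1 hq).trans k.le_succ)
  rw [Finset.card_sdiff_of_subset hsub, card_supBall, card_supBall, tsub_le_iff_right]
  have h := abs_pow_sub_pow_le (a := (2 * (k + 1) + 1 : ℤ)) (b := 2 * k + 1) (n := n)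
  rw [max_eq_left (by rw [abs_of_nonneg, abs_of_nonneg] <;> omega),
    abs_of_nonneg (a := (2 * (k + 1) + 1 : ℤ)) (by omega),
    show (2 * (k + 1) + 1 : ℤ) - (2 * k + 1) = 2 by ring, abs_two] at h
  have hpow : (2 * (k + 1) + 1 : ℤ) ^ (n - 1) ≤ 3 ^ (n - 1) * (k + 1) ^ (n - 1) := by
    rw [← mul_pow]
    exact pow_le_pow_left₀ (by omega) (by omega) _
  have h' := (le_abs_self _).trans (h.trans (mul_le_mul_of_nonneg_left hpow (by positivity)))
  zify
  linarith

/-- A radial function of integer vectors in `ℤ^n` is summable as soon as the series weighted by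
`q ^ (n - 1)` converges. -/
theorem tsum_comp_supNatAbs_ne_top (n : ℕ) (g : ℕ → ENNReal) (h0 : g 0 ≠ ⊤)
    (hg : ∑' k : ℕ, ((k + 1 : ℕ) : ENNReal) ^ (n - 1) * g (k + 1) ≠ ⊤) :
    ∑' q : Fin n → ℤ, g (supNatAbs q) ≠ ⊤ := by
  have hfib : ∀ (k : ℕ) (F : Finset (Fin n → ℤ)), (∀ q, supNatAbs q = k → q ∈ F) →
      ∑' q : supNatAbs (n := n) ⁻¹' {k}, g (supNatAbs (q : Fin n → ℤ)) ≤ F.card * g k := by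
    intro k F hF
    calc ∑' q : supNatAbs (n := n) ⁻¹' {k}, g (supNatAbs (q : Fin n → ℤ))
        = ∑' q : supNatAbs (n := n) ⁻¹' {k}, (fun _ : Fin n → ℤ => g k) q :=
          tsum_congr fun q => by rw [show supNatAbs (q : Fin n → ℤ) = k from q.2]
      _ ≤ ∑' q : (F : Set (Fin n → ℤ)), (fun _ : Fin n → ℤ => g k) q :=
          ENNReal.tsum_mono_subtype (fun _ : Fin n → ℤ => g k)
            (show supNatAbs ⁻¹' {k} ⊆ (F : Set (Fin n → ℤ)) from fun q hq => hF q hq)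
      _ = F.card * g k := by
          rw [Finset.tsum_subtype' F (fun _ => g k), Finset.sum_const, nsmul_eq_mul]
  rw [← ENNReal.tsum_fiberwise _ supNatAbs, tsum_eq_zero_add' ENNReal.summable]
  refine ENNReal.add_ne_top.2 ⟨?_, ?_⟩
  · exact ne_top_of_le_ne_top (ENNReal.mul_ne_top (ENNReal.natCast_ne_top _) h0)
      (hfib 0 (supBall n 0) fun q hq => mem_supBall.2 hq.le)
  · refine ne_top_of_le_ne_top
      (ENNReal.mul_ne_top (ENNReal.natCast_ne_top (2 * n * 3 ^ (n - 1))) hg) ?_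
    rw [← ENNReal.tsum_mul_left]
    refine ENNReal.tsum_le_tsum fun k => ?_
    refine (hfib (k + 1) (supBall n (k + 1) \ supBall n k) fun q hq => ?_).trans ?_
    · simp [mem_supBall, hq]
    · rw [← mul_assoc]
      gcongr
      exact_mod_cast card_supBall_sdiff_le n k

/-- If `x - b` is within `r ≤ 1` of an integer point and `b ∈ [0,1]^m`, then `b` is within `r` of
one of boundedly many explicit translates of the fractional part of `x`. -/
theorem exists_mem_ball_of_intDist_lt {m : ℕ} {x b : Fin m → ℝ} {r : ℝ}
    (hb : b ∈ Set.Icc (0 : Fin m → ℝ) 1) (hr : r ≤ 1) (h : intDist (x - b) < r) :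
    ∃ t : Fin m → Fin 4,
      b ∈ Metric.ball (fun i => Int.fract (x i) + ((t i : ℕ) : ℝ) - 1) r := by
  obtain ⟨p, hp⟩ := exists_lt_of_ciInf_lt h
  have hr0 : 0 < r := (norm_nonneg _).trans_lt hp
  rw [pi_norm_lt_iff hr0] at hp
  have ht : ∀ i, ∃ t : Fin 4, ((t : ℕ) : ℤ) = ⌊x i⌋ - p i + 1 := by
    intro i
    have hi := abs_lt.1 (hp i)
    simp only [Pi.sub_apply] at hi
    have h0 : 0 ≤ b i := hb.1 i
    have h1 : b i ≤ 1 := hb.2 i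
    have hf := Int.floor_le (x i)
    have hf' := Int.lt_floor_add_one (x i)
    have hlo : (-2 : ℤ) < ⌊x i⌋ - p i := by
      have : ((-2 : ℤ) : ℝ) < ((⌊x i⌋ - p i : ℤ) : ℝ) := by push_cast; linarith
      exact_mod_cast this
    have hhi : ⌊x i⌋ - p i < 2 := by
      have : ((⌊x i⌋ - p i : ℤ) : ℝ) < ((2 : ℤ) : ℝ) := by push_cast; linarith
      exact_mod_cast this
    exact ⟨⟨(⌊x i⌋ - p i + 1).toNat, by omega⟩, by simp only; omega⟩
  choose t ht using ht
  refine ⟨t, ?_⟩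
  rw [Metric.mem_ball, dist_comm, dist_eq_norm, pi_norm_lt_iff hr0]
  intro i
  have hti : ((t i : ℕ) : ℝ) = ⌊x i⌋ - p i + 1 := by
    exact_mod_cast congrArg (Int.cast (R := ℝ)) (ht i)
  convert! hp i using 2
  simp only [Pi.sub_apply, hti, Int.fract]
  ring

/-- Convergent part: for every `A`, decreasing `ψ` and `0 ≤ s ≤ m`, if
`∑ q^{n-1} ψ(q)^s < ∞` then `ℋ^s(W_A(ψ)) = 0`. -/
theorem convergent_part (m n : ℕ) (hm : 0 < m) (hn : 0 < n)
    (A : Matrix (Fin m) (Fin n) ℝ)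
    (ψ : ℝ → ℝ) (hψpos : ∀ r : ℝ, 0 < r → 0 < ψ r)
    (hψdec : ∀ x y : ℝ, 0 < x → x ≤ y → ψ y ≤ ψ x)
    (s : ℝ) (hs0 : 0 ≤ s) (hsm : s ≤ m)
    (hsum : Summable (fun q : ℕ => ((q : ℝ) + 1) ^ (n - 1) * ψ ((q : ℝ) + 1) ^ s)) :
    μH[s] (WA m n A ψ) = 0 := by
  rcases hs0.eq_or_lt with rfl | hs
  · exfalso
    have hlim := hsum.tendsto_atTop_zero
    have h1 : ∀ q : ℕ, 1 ≤ ((q : ℝ) + 1) ^ (n - 1) * ψ ((q : ℝ) + 1) ^ (0 : ℝ) := fun q => by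
      rw [Real.rpow_zero, mul_one]
      exact one_le_pow₀ (by linarith [q.cast_nonneg (α := ℝ)])
    linarith [ge_of_tendsto' hlim h1]
  have hpos : ∀ k : ℕ, 0 < ψ ((k : ℝ) + 1) := fun k => hψpos _ (by positivity)
  obtain ⟨K, hK⟩ : ∃ K : ℕ, ψ ((K : ℝ) + 1) ≤ 1 := by
    obtain ⟨K, hK⟩ := (hsum.tendsto_atTop_zero.eventually_lt_const one_pos).exists
    refine ⟨K, ?_⟩
    by_contra! hlt
    have h1 : 1 ≤ ((K : ℝ) + 1) ^ (n - 1) := one_le_pow₀ (by linarith [K.cast_nonneg (α := ℝ)])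
    have h2 : 1 ≤ ψ ((K : ℝ) + 1) ^ s := Real.one_le_rpow hlt.le hs0
    linarith [one_le_mul_of_one_le_of_one_le h1 h2]
  have hq : ∑' q : Fin n → ℤ, ENNReal.ofReal (ψ (supNatAbs q)) ^ s ≠ ⊤ := by
    refine tsum_comp_supNatAbs_ne_top n (fun k => ENNReal.ofReal (ψ k) ^ s)
      (ENNReal.rpow_ne_top_of_nonneg hs0 ENNReal.ofReal_ne_top) ?_
    convert! hsum.tsum_ofReal_ne_top using 3 with k
    rw [ENNReal.ofReal_mul (by positivity), ENNReal.ofReal_pow (by positivity),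
      ENNReal.ofReal_rpow_of_nonneg (by simpa using (hpos k).le) hs0,
      ← Nat.cast_add_one, ENNReal.ofReal_natCast]
  let E : (Fin n → ℤ) × (Fin m → Fin 4) → Set (Fin m → ℝ) := fun z =>
    Metric.ball (fun i => Int.fract (A.mulVec (fun j => (z.1 j : ℝ)) i) + ((z.2 i : ℕ) : ℝ) - 1)
      (ψ (supNatAbs z.1))
  have hE : ∑' z, Metric.ediam (E z) ^ s ≠ ⊤ := by
    have hbound : ∀ z, Metric.ediam (E z) ^ s ≤
        2 ^ s * ENNReal.ofReal (ψ (supNatAbs z.1)) ^ s := fun z => by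
      rw [← ENNReal.mul_rpow_of_nonneg _ _ hs0]
      refine ENNReal.rpow_le_rpow ?_ hs0
      simp only [E, ← Metric.eball_ofReal]
      exact Metric.ediam_eball_le
    refine ne_top_of_le_ne_top ?_ (ENNReal.tsum_le_tsum hbound)
    rw [ENNReal.tsum_mul_left, ENNReal.tsum_prod', ENNReal.tsum_comm]
    refine ENNReal.mul_ne_top (ENNReal.rpow_ne_top_of_nonneg hs0 ENNReal.ofNat_ne_top) ?_
    rw [tsum_fintype]
    exact ENNReal.sum_ne_top.2 fun _ _ => hq
  refine measure_mono_null ?_ (hausdorffMeasure_limsup_cofinite_eq_zero hs E hE)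
  rintro b ⟨hb, hinf⟩
  refine Set.Infinite.of_image Prod.fst
    ((hinf.sdiff (supBall n K).finite_toSet).mono ?_)
  rintro q ⟨hqlt, hqK⟩
  rw [Finset.mem_coe, mem_supBall, not_le] at hqK
  rw [Set.mem_ofPred_eq, norm_intCast_eq_supNatAbs] at hqlt
  have hle : ψ (supNatAbs q) ≤ 1 :=
    (hψdec _ _ (by positivity) (by exact_mod_cast hqK)).trans hK
  obtain ⟨t, ht⟩ := exists_mem_ball_of_intDist_lt hb hle hqlt
  exact ⟨(q, t), ht, rfl⟩
end
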